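/- arXiv:math/9909141 — 5 statements merged into one kernel-verified Lean document; each statement's English description precedes it below -/
import Mathlib

section
/- Let n ≥ 1 and let σ_0, σ_1, …, σ_n ∈ ℝ^n. For each j ∈ {0, …, n} let σ^j denote the n×n matrix whose columns are σ_0, …, σ_{j−1}, σ_{j+1}, …, σ_n in that order, and let D_j = det(σ^j). Then for every x ∈ ℝ^n satisfying ⟨x, σ_j⟩ ≠ 0 for all j = 0, …, n, one has Σ_{j=0}^{n} (−1)^j · D_j / ∏_{k ≠ j} ⟨x, σ_k⟩ = 0. -/
/-- A linear functional `⟨x, ·⟩` annihilates the Cramer relation between `n + 1` vectors of `Rⁿ`. -/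
theorem sum_neg_one_pow_mul_dot_mul_det_eq_zero {R : Type*} [CommRing R] [IsDomain R] {n : ℕ}
    (σ : Fin (n + 1) → Fin n → R) (x : Fin n → R) :
    ∑ j : Fin (n + 1), (-1 : R) ^ (j : ℕ) * (∑ i, x i * σ j i) *
      (Matrix.of fun i k => σ (j.succAbove k) i).det = 0 := by
  let M : Matrix (Fin (n + 1)) (Fin (n + 1)) R :=
    Matrix.of (Fin.cons (fun k => ∑ i, x i * σ k i) fun i k => σ k i)
  have hM : M.det = 0 := by
    refine Matrix.exists_vecMul_eq_zero_iff.mp ⟨Fin.cons 1 (-x), fun h => ?_, ?_⟩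
    · simpa using congrFun h 0
    · ext k
      simp [M, Matrix.vecMul, dotProduct, Fin.sum_univ_succ]
  rw [← hM, Matrix.det_succ_row_zero]
  rfl

/-- The rational-function identity underlying Dedekind reciprocity:
for `σ_0, …, σ_n ∈ ℝ^n` and `x` with `⟨x, σ_j⟩ ≠ 0` for all `j`,
`∑_j (-1)^j D_j / ∏_{k ≠ j} ⟨x, σ_k⟩ = 0`, where `D_j` is the determinant of
the matrix with columns `σ_0, …, σ̂_j, …, σ_n`. -/
theorem dedekind_rational_identity (n : ℕ) (hn : 1 ≤ n)
    (σ : Fin (n + 1) → Fin n → ℝ) (x : Fin n → ℝ)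
    (hx : ∀ j, (∑ i, x i * σ j i) ≠ 0) :
    ∑ j : Fin (n + 1), (-1 : ℝ) ^ (j : ℕ) *
      (Matrix.of fun i k => σ (j.succAbove k) i).det /
      ∏ k ∈ Finset.univ.erase j, (∑ i, x i * σ k i) = 0 := by
  have hdiv : ∀ j ∈ (Finset.univ : Finset (Fin (n + 1))),
      (-1 : ℝ) ^ (j : ℕ) * (Matrix.of fun i k => σ (j.succAbove k) i).det /
        ∏ k ∈ Finset.univ.erase j, (∑ i, x i * σ k i) =
      ((-1 : ℝ) ^ (j : ℕ) * (∑ i, x i * σ j i) *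
        (Matrix.of fun i k => σ (j.succAbove k) i).det) / ∏ k, ∑ i, x i * σ k i := by
    intro j hj
    rw [← Finset.mul_prod_erase _ _ hj, mul_right_comm, mul_comm _ (∑ i, x i * σ j i),
      mul_div_mul_left _ _ (hx j)]
  rw [Finset.sum_congr rfl hdiv, ← Finset.sum_div,
    sum_neg_one_pow_mul_dot_mul_det_eq_zero, zero_div]
end

section
/- Let n ≥ 1, let σ be an n×n integer matrix with columns σ_1, …, σ_n and det σ ≠ 0, let v ∈ ℚ^n, and let e_1, …, e_n be integers with each e_j ≥ 2. Set N = e_1 + ⋯ + e_n. Then there exists a rational number q such that Σ'_{x ∈ ℤ^n} e(⟨x, v⟩) · det σ / (⟨x, σ_1⟩^{e_1} ⋯ ⟨x, σ_n⟩^{e_n}) = q · (2πi)^N; that is, the Dedekind sum is, up to the power (2πi)^N, a rational number whenever v is rational. -/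
open Finset

/-- The additive character `t ↦ e(t) = exp (2πit)` on the rational numbers. -/
noncomputable def ratExp (t : ℚ) : ℂ := Complex.exp (2 * (Real.pi : ℂ) * Complex.I * (t : ℂ))

lemma ratExp_zero : ratExp 0 = 1 := by simp [ratExp]

lemma ratExp_add (s t : ℚ) : ratExp (s + t) = ratExp s * ratExp t := by
  simp only [ratExp, Rat.cast_add, mul_add, Complex.exp_add]

lemma ratExp_sum {ι : Type*} (s : Finset ι) (f : ι → ℚ) :
    ratExp (∑ i ∈ s, f i) = ∏ i ∈ s, ratExp (f i) := by
  classical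
  induction s using Finset.induction_on with
  | empty => simp [ratExp_zero]
  | insert a s ha ih => rw [sum_insert ha, prod_insert ha, ratExp_add, ih]

lemma ratExp_nat_mul (k : ℕ) (t : ℚ) : ratExp (k * t) = ratExp t ^ k := by
  simp only [ratExp, ← Complex.exp_nat_mul]
  push_cast
  ring_nf

lemma norm_ratExp (t : ℚ) : ‖ratExp t‖ = 1 := by
  have : 2 * (Real.pi : ℂ) * Complex.I * (t : ℂ) = ((2 * Real.pi * t : ℝ) : ℂ) * Complex.I := by
    push_cast
    ring
  rw [ratExp, this, Complex.norm_exp_ofReal_mul_I]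

lemma ratExp_eq_one_iff (t : ℚ) : ratExp t = 1 ↔ ∃ k : ℤ, t = k := by
  rw [ratExp, Complex.exp_eq_one_iff]
  refine exists_congr fun k => ?_
  rw [mul_comm, mul_left_inj' Complex.two_pi_I_ne_zero]
  norm_cast

lemma ratExp_int (k : ℤ) : ratExp k = 1 := (ratExp_eq_one_iff _).2 ⟨k, rfl⟩

/-- Orthogonality of the additive characters modulo `d`. -/
lemma sum_ratExp_div (d : ℤ) (hd : d ≠ 0) (m : ℤ) :
    ∑ k ∈ range d.natAbs, ratExp (m * k / d) = if d ∣ m then (d.natAbs : ℂ) else 0 := by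
  have hdq : (d : ℚ) ≠ 0 := by exact_mod_cast hd
  have hpow (k : ℕ) : ratExp (m * k / d) = ratExp (m / d) ^ k := by
    rw [← ratExp_nat_mul]
    ring_nf
  have hone : ratExp (m / d) = 1 ↔ d ∣ m := by
    rw [ratExp_eq_one_iff]
    refine exists_congr fun k => ?_
    rw [div_eq_iff hdq, mul_comm]
    norm_cast
  simp_rw [hpow]
  split_ifs with h
  · simp [hone.2 h]
  · have hroot : ratExp (m / d) ^ d.natAbs = 1 := by
      rw [← ratExp_nat_mul]
      rcases Int.natAbs_eq d with h' | h'
      · have : ((d.natAbs : ℤ) : ℚ) = d := by rw [← h']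
        rw [← Int.cast_natCast, this, mul_div_cancel₀ _ hdq, ratExp_int]
      · have : ((d.natAbs : ℤ) : ℚ) = -d := by
          rw [show (d.natAbs : ℤ) = -d by omega, Int.cast_neg]
        rw [← Int.cast_natCast, this, neg_mul, mul_div_cancel₀ _ hdq]
        exact_mod_cast ratExp_int (-m)
    rw [geom_sum_eq (fun h' => h (hone.1 h')), hroot, sub_self, zero_div]

lemma summable_norm_ratExp_div_pow {k : ℕ} (hk : 2 ≤ k) (w : ℚ) :
    Summable fun m : ℤ => ‖ratExp (m * w) / (m : ℂ) ^ k‖ := by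
  refine ((Real.summable_one_div_int_pow (p := k)).2 (by omega)).abs.congr fun m => ?_
  simp [norm_ratExp, abs_inv]

/-- The value of a rational Bernoulli polynomial at a rational point is rational. -/
lemma bernoulliFun_ratCast (k : ℕ) (w : ℚ) :
    bernoulliFun k (w : ℝ) = ((Polynomial.bernoulli k).eval w : ℚ) := by
  simpa [bernoulliFun] using
    Polynomial.aeval_algebraMap_apply_eq_algebraMap_eval (A := ℝ) w (Polynomial.bernoulli k)

lemma exists_tsum_ratExp_div_pow {k : ℕ} (hk : 2 ≤ k) (w : ℚ) :
    ∃ q : ℚ, ∑' m : ℤ, ratExp (m * w) / (m : ℂ) ^ k =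
      q * (2 * (Real.pi : ℂ) * Complex.I) ^ k := by
  have hx : ((Int.fract w : ℚ) : ℝ) ∈ Set.Icc (0 : ℝ) 1 :=
    ⟨by exact_mod_cast Int.fract_nonneg w, by exact_mod_cast (Int.fract_lt_one w).le⟩
  have key := (hasSum_one_div_pow_mul_fourier_mul_bernoulliFun hk hx).tsum_eq
  refine ⟨-((Polynomial.bernoulli k).eval (Int.fract w)) / (k.factorial : ℚ), ?_⟩
  rw [bernoulliFun_ratCast] at key
  have hterm (m : ℤ) : ratExp (m * w) / (m : ℂ) ^ k =
      1 / (m : ℂ) ^ k * fourier m (((Int.fract w : ℚ) : ℝ) : UnitAddCircle) := by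
    have h : (m : ℚ) * w = ((m * ⌊w⌋ : ℤ) : ℚ) + m * Int.fract w := by
      push_cast
      rw [← mul_add, Int.floor_add_fract]
    rw [h, ratExp_add, ratExp_int, fourier_coe_apply, ratExp]
    generalize Int.fract w = t
    push_cast
    ring_nf
  simp_rw [hterm]
  rw [key]
  push_cast
  ring

/-- Fubini for a finite product of absolutely convergent series. -/
lemma summable_norm_and_hasSum_pi_prod {ι : Type*} {n : ℕ} (f : Fin n → ι → ℂ)
    (hf : ∀ j, Summable fun m => ‖f j m‖) :
    (Summable fun y : Fin n → ι => ‖∏ j, f j (y j)‖) ∧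
      HasSum (fun y : Fin n → ι => ∏ j, f j (y j)) (∏ j, ∑' m, f j m) := by
  induction n with
  | zero =>
    refine ⟨Summable.of_finite, ?_⟩
    simp [hasSum_unique]
  | succ n ih =>
    obtain ⟨hs, hsum⟩ := ih (fun j => f j.succ) fun j => hf j.succ
    constructor
    · rw [← (Fin.consEquiv fun _ => ι).summable_iff]
      refine ((hf 0).mul_norm hs).congr fun p => ?_
      simp [Fin.prod_univ_succ, Fin.consEquiv]
    · rw [← (Fin.consEquiv fun _ => ι).hasSum_iff, Fin.prod_univ_succ, ← hsum.tsum_eq,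
        tsum_mul_tsum_of_summable_norm (hf 0) hs]
      refine (summable_mul_of_summable_norm (hf 0) hs).hasSum.congr_fun ?_
      simp [Fin.prod_univ_succ, Fin.consEquiv]

/-- For a nonsingular integer matrix, `y` lies in the row lattice of `σ` exactly when
`det σ` divides every coordinate of `y * adj σ`. -/
lemma mem_range_vecMul_iff {n : ℕ} (σ : Matrix (Fin n) (Fin n) ℤ) (hσ : σ.det ≠ 0)
    (y : Fin n → ℤ) :
    y ∈ Set.range (fun x => Matrix.vecMul x σ) ↔
      ∀ i, σ.det ∣ Matrix.vecMul y σ.adjugate i := by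
  constructor
  · rintro ⟨x, rfl⟩ i
    simp [Matrix.vecMul_vecMul, Matrix.mul_adjugate]
  · intro h
    choose x hx using h
    refine ⟨x, ?_⟩
    have h1 : Matrix.vecMul y σ.adjugate = σ.det • x := funext fun i => by simp [hx i]
    have h2 := congrArg (fun z => Matrix.vecMul z σ) h1
    simp only [Matrix.vecMul_vecMul, Matrix.adjugate_mul, Matrix.vecMul_smul, Matrix.smul_vecMul,
      Matrix.vecMul_one] at h2
    exact (smul_right_injective _ hσ h2).symm

lemma vecMul_injective_of_det_ne_zero {n : ℕ} (σ : Matrix (Fin n) (Fin n) ℤ) (hσ : σ.det ≠ 0) :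
    Function.Injective fun x => Matrix.vecMul x σ := by
  intro x x' h
  have h2 := congrArg (fun z => Matrix.vecMul z σ.adjugate) h
  simp only [Matrix.vecMul_vecMul, Matrix.mul_adjugate, Matrix.vecMul_smul,
    Matrix.vecMul_one] at h2
  exact smul_right_injective _ hσ h2

/-- The indicator function of the row lattice of `σ` as a sum of characters. -/
lemma sum_ratExp_adjugate {n : ℕ} (σ : Matrix (Fin n) (Fin n) ℤ) (hσ : σ.det ≠ 0)
    (y : Fin n → ℤ) [Decidable (y ∈ Set.range fun x => Matrix.vecMul x σ)] :
    ∑ k ∈ Fintype.piFinset fun _ : Fin n => range σ.det.natAbs,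
        ratExp (∑ i, ((Matrix.vecMul y σ.adjugate i : ℤ) : ℚ) * k i / σ.det) =
      if y ∈ Set.range (fun x => Matrix.vecMul x σ) then (σ.det.natAbs : ℂ) ^ n else 0 := by
  simp_rw [ratExp_sum]
  rw [← prod_univ_sum (fun _ : Fin n => range σ.det.natAbs)
    fun i k => ratExp (((Matrix.vecMul y σ.adjugate i : ℤ) : ℚ) * k / σ.det)]
  simp_rw [sum_ratExp_div _ hσ]
  split_ifs with h
  · rw [mem_range_vecMul_iff σ hσ] at h
    simp [h]
  · rw [mem_range_vecMul_iff σ hσ] at h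
    push Not at h
    obtain ⟨i, hi⟩ := h
    exact prod_eq_zero (mem_univ i) (if_neg hi)

lemma sum_vecMul_mul_div {n : ℕ} (A : Matrix (Fin n) (Fin n) ℤ) (d : ℚ) (y : Fin n → ℤ)
    (u : Fin n → ℚ) :
    ∑ i, ((Matrix.vecMul y A i : ℤ) : ℚ) * u i / d = ∑ j, (y j : ℚ) * ∑ i, (A j i : ℚ) * u i / d := by
  simp only [Matrix.vecMul, dotProduct, Int.cast_sum, Int.cast_mul, sum_mul, sum_div, mul_sum]
  rw [sum_comm]
  exact sum_congr rfl fun j _ => sum_congr rfl fun i _ => by ring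

/-- Rationality of Dedekind sums: for `v ∈ ℚ^n` and all `e_j ≥ 2`, the Dedekind sum
`Σ'_{x ∈ ℤ^n} e(⟨x,v⟩) det σ / ∏ ⟨x,σ_j⟩^{e_j}` equals `q · (2πi)^N` with `q ∈ ℚ`,
where `N = e_1 + ⋯ + e_n`. -/
theorem dedekind_sum_rationality (n : ℕ) (hn : 1 ≤ n)
    (σ : Matrix (Fin n) (Fin n) ℤ) (hσ : σ.det ≠ 0)
    (v : Fin n → ℚ) (e : Fin n → ℕ) (he : ∀ j, 2 ≤ e j) :
    ∃ q : ℚ,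
      (∑' x : {x : Fin n → ℤ // ∀ j, (∑ i, x i * σ i j) ≠ 0},
        Complex.exp (2 * (Real.pi : ℂ) * Complex.I * ((∑ i, (x.1 i : ℚ) * v i : ℚ) : ℂ)) *
          (σ.det : ℂ) / ∏ j, (∑ i, (x.1 i : ℂ) * (σ i j : ℂ)) ^ (e j)) =
      (q : ℂ) * (2 * (Real.pi : ℂ) * Complex.I) ^ (∑ j, e j) := by
  classical
  set d := σ.det with hd
  have hdq : (d : ℚ) ≠ 0 := by exact_mod_cast hσ
  let K := Fintype.piFinset fun _ : Fin n => range d.natAbs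
  let w (u : Fin n → ℚ) (j : Fin n) : ℚ := ∑ i, (σ.adjugate j i : ℚ) * u i / d
  let F (y : Fin n → ℤ) : ℂ := ratExp (∑ j, (y j : ℚ) * w v j) * (d : ℂ) / ∏ j, (y j : ℂ) ^ e j
  let L : (Fin n → ℤ) → (Fin n → ℤ) := fun x => Matrix.vecMul x σ
  have hFL (x : Fin n → ℤ) : F (L x) = ratExp (∑ i, (x i : ℚ) * v i) *
      (d : ℂ) / ∏ j, (∑ i, (x i : ℂ) * (σ i j : ℂ)) ^ (e j) := by
    simp only [F, w]
    rw [← sum_vecMul_mul_div]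
    congr 3
    · refine sum_congr rfl fun i _ => ?_
      simp only [L, Matrix.vecMul_vecMul, Matrix.mul_adjugate, Matrix.vecMul_smul,
        Matrix.vecMul_one, ← hd, Pi.smul_apply, smul_eq_mul, Int.cast_mul]
      field_simp
    · simp [L, Matrix.vecMul, dotProduct]
  have hsub : (∑' x : {x : Fin n → ℤ // ∀ j, (∑ i, x i * σ i j) ≠ 0},
        Complex.exp (2 * (Real.pi : ℂ) * Complex.I * ((∑ i, (x.1 i : ℚ) * v i : ℚ) : ℂ)) *
          (d : ℂ) / ∏ j, (∑ i, (x.1 i : ℂ) * (σ i j : ℂ)) ^ (e j)) = ∑' x, F (L x) := by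
    rw [← tsum_subtype_eq_of_support_subset
      (s := {x : Fin n → ℤ | ∀ j, (∑ i, x i * σ i j) ≠ 0})]
    · exact tsum_congr fun x => (hFL x.1).symm
    · intro x hx j hj
      refine hx ?_
      have hj' : ((L x j : ℤ) : ℂ) = 0 := by exact_mod_cast hj
      have : ∏ j, ((L x j : ℤ) : ℂ) ^ e j = 0 := prod_eq_zero (mem_univ j) <| by
        rw [hj', zero_pow (by have := he j; omega)]
      simp only [F, this, div_zero]
  let G (y : Fin n → ℤ) : ℂ := if y ∈ Set.range L then F y else 0
  have hlat : ∑' x, F (L x) = ∑' y, G y := by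
    rw [← (vecMul_injective_of_det_ne_zero σ hσ).tsum_eq (f := G)]
    · exact tsum_congr fun x => (if_pos ⟨x, rfl⟩).symm
    · intro y hy
      by_contra h
      exact hy (if_neg h)
  have hexp (y : Fin n → ℤ) : (d.natAbs : ℂ) ^ n * G y = ∑ k ∈ K, (d : ℂ) *
      ∏ j, ratExp (y j * w (fun i => v i + k i) j) / (y j : ℂ) ^ e j := by
    have h1 : (d.natAbs : ℂ) ^ n * G y =
        (if y ∈ Set.range L then (d.natAbs : ℂ) ^ n else 0) * F y := by
      simp only [G]
      split_ifs <;> simp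
    rw [h1, ← sum_ratExp_adjugate σ hσ y, sum_mul]
    refine sum_congr rfl fun k _ => ?_
    rw [sum_vecMul_mul_div σ.adjugate (σ.det : ℚ) y fun i => (k i : ℚ), prod_div_distrib,
      ← ratExp_sum]
    have h2 : ∑ j, (y j : ℚ) * w (fun i => v i + k i) j =
        ∑ j, (y j : ℚ) * w (fun i => (k i : ℚ)) j + ∑ j, (y j : ℚ) * w v j := by
      simp only [w, ← sum_add_distrib, ← mul_add]
      exact sum_congr rfl fun j _ => congrArg _ (sum_congr rfl fun i _ => by ring)
    rw [h2, ratExp_add]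
    simp only [F, w, ← hd]
    ring
  choose q hq using fun (k : Fin n → ℕ) j =>
    exists_tsum_ratExp_div_pow (he j) (w (fun i => v i + k i) j)
  have hsum : HasSum (fun y => (d.natAbs : ℂ) ^ n * G y)
      (∑ k ∈ K, (d : ℂ) * ∏ j, ((q k j : ℂ) * (2 * (Real.pi : ℂ) * Complex.I) ^ e j)) := by
    simp_rw [hexp, ← hq]
    refine hasSum_sum fun k _ => HasSum.mul_left _ ?_
    exact (summable_norm_and_hasSum_pi_prod _ fun j => summable_norm_ratExp_div_pow (he j) _).2
  have hD : (d.natAbs : ℂ) ^ n ≠ 0 := pow_ne_zero _ (by exact_mod_cast Int.natAbs_ne_zero.2 hσ)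
  refine ⟨(∑ k ∈ K, (d : ℚ) * ∏ j, q k j) / (d.natAbs : ℚ) ^ n, ?_⟩
  rw [hsub, hlat]
  have := hsum.tsum_eq
  rw [tsum_mul_left] at this
  rw [← mul_right_inj' hD, this]
  simp_rw [prod_mul_distrib, prod_pow_eq_pow_sum, ← mul_assoc]
  rw [← sum_mul]
  congr 1
  push_cast
  field_simp
end

section
/- For every integer m ≥ 1, 6 · Σ_{a, b ≥ 1} 1/(a·b·(a+b))^{2m} = 8 · Σ_{0 ≤ i ≤ 2m, i even} C(4m−i−1, 2m−1) · ζ(i) · ζ(6m−i), where the sum on the left ranges over all pairs of positive integers (a, b) and converges absolutely. Equivalently, (6/2^{2m}) ζ_{𝔰𝔩₃}(2m) = 8 Σ_{i even, 0 ≤ i ≤ 2m} C(4m−i−1, 2m−1) ζ(i) ζ(6m−i), where ζ_{𝔰𝔩₃}(s) = Σ_{a,b ≥ 1} (a b (a+b)/2)^{−s} is the Witten zeta function of 𝔰𝔩₃. -/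
open Finset

theorem HasSum.of_forall_eq {ι α : Type*} [AddCommMonoid α] [TopologicalSpace α] {f g : ι → α}
    {s t : α} (h : HasSum f s) (hfg : ∀ i, g i = f i) (hst : t = s) : HasSum g t := by
  rwa [funext hfg, hst]

theorem one_sub_mul_sum_choose_pow {R : Type*} [CommRing R] (u v : R) (h : u + v = 1) (q p : ℕ) :
    v * ∑ j ∈ range (p + 1), ((q + 1 + j).choose (q + 1) : R) * u ^ j =
      ∑ j ∈ range (p + 1), ((q + j).choose q : R) * u ^ j -
        ((q + p + 1).choose (q + 1) : R) * u ^ (p + 1) := by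
  obtain rfl : v = 1 - u := by rw [← h]; ring
  induction p with
  | zero => simp
  | succ p ih =>
    rw [sum_range_succ, mul_add, ih, sum_range_succ _ (p + 1)]
    have e : (q + (p + 1) + 1).choose (q + 1) =
        (q + (p + 1)).choose q + (q + p + 1).choose (q + 1) := Nat.choose_succ_succ _ _
    rw [show q + 1 + (p + 1) = q + (p + 1) + 1 by ring, e]
    push_cast
    ring

theorem sum_choose_mul_pow_eq_one {R : Type*} [CommRing R] (u v : R) (h : u + v = 1) (r : ℕ) :
    ∑ j ∈ range (r + 1), ((r + j).choose r : R) * (u ^ j * v ^ (r + 1) + v ^ j * u ^ (r + 1))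
      = 1 := by
  have split (r : ℕ) : ∑ j ∈ range (r + 1),
      ((r + j).choose r : R) * (u ^ j * v ^ (r + 1) + v ^ j * u ^ (r + 1)) =
      v ^ (r + 1) * ∑ j ∈ range (r + 1), ((r + j).choose r : R) * u ^ j +
      u ^ (r + 1) * ∑ j ∈ range (r + 1), ((r + j).choose r : R) * v ^ j := by
    rw [mul_sum, mul_sum, ← sum_add_distrib]
    exact sum_congr rfl fun _ _ => by ring
  induction r with
  | zero => simp [add_comm v u, h]
  | succ r ih =>
    rw [split] at ih ⊢
    have h1 := one_sub_mul_sum_choose_pow u v h r (r + 1)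
    have h2 := one_sub_mul_sum_choose_pow v u (by rw [add_comm, h]) r (r + 1)
    rw [sum_range_succ (fun j => ((r + j).choose r : R) * _) (r + 1)] at h1 h2
    have e : (r + (r + 1) + 1).choose (r + 1) = 2 * (r + (r + 1)).choose r := by
      rw [Nat.choose_succ_succ, two_mul]
      congr 1
      exact Nat.choose_symm_of_eq_add (by omega)
    rw [e] at h1 h2
    push_cast at h1 h2
    rw [pow_succ v, pow_succ u, mul_assoc, mul_assoc, h1, h2]
    linear_combination ih - 2 * ((r + (r + 1)).choose r : R) * u ^ (r+1) * v ^ (r+1) * h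

theorem inv_pow_mul_inv_pow_eq_sum {K : Type*} [Field K] (n : ℕ) (hn : 1 ≤ n) (x y s : K)
    (hx : x ≠ 0) (hy : y ≠ 0) (hs : s ≠ 0) (h : x + y = s) :
    (x ^ n)⁻¹ * (y ^ n)⁻¹ = ∑ k ∈ range n, ((2 * n - (k + 1) - 1).choose (n - 1) : K) *
      (s ^ (2 * n - (k + 1)))⁻¹ * ((x ^ (k + 1))⁻¹ + (y ^ (k + 1))⁻¹) := by
  obtain ⟨r, rfl⟩ : ∃ r, n = r + 1 := ⟨n - 1, by omega⟩
  have key := sum_choose_mul_pow_eq_one (x / s) (y / s) (by field_simp; exact h) r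
  rw [← sum_range_reflect] at key
  rw [← mul_one ((x ^ (r + 1))⁻¹ * (y ^ (r + 1))⁻¹), ← key, mul_sum]
  refine sum_congr rfl fun k hk => ?_
  obtain ⟨j, rfl⟩ : ∃ j, r = k + j := ⟨r - k, by have := mem_range.1 hk; omega⟩
  rw [show k + j + 1 - 1 - k = j by omega, show 2 * (k + j + 1) - (k + 1) - 1 = k + j + j by omega,
    show k + j + 1 - 1 = k + j by omega, show 2 * (k + j + 1) - (k + 1) = k + j + j + 1 by omega]
  simp only [div_pow, pow_add, pow_one]
  field_simp

theorem sum_choose_two_mul_sub (n : ℕ) (hn : 1 ≤ n) :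
    ∑ k ∈ range n, (2 * n - (k + 1) - 1).choose (n - 1) = (2 * n - 1).choose (n - 1) := by
  obtain ⟨r, rfl⟩ : ∃ r, n = r + 1 := ⟨n - 1, by omega⟩
  have h := Nat.sum_range_add_choose r r
  rw [← sum_range_reflect] at h
  rw [show 2 * (r + 1) - 1 = r + r + 1 by omega, Nat.add_sub_cancel,
    Nat.choose_symm_of_eq_add (show r + r + 1 = r + (r + 1) by ring), ← h]
  refine sum_congr rfl fun k hk => ?_
  have := mem_range.1 hk
  congr 1
  omega

theorem hasSum_int_inv_pow_of_even {k : ℕ} (hk : 1 < k) (he : Even k) :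
    HasSum (fun a : ℤ => ((a : ℂ) ^ k)⁻¹) (2 * riemannZeta k) := by
  have hs : Summable fun n : ℕ => ((n : ℂ) ^ k)⁻¹ := 
    Summable.of_norm (by simpa using Real.summable_one_div_nat_pow.2 hk)
  have hz : HasSum (fun n : ℕ => ((n : ℂ) ^ k)⁻¹) (riemannZeta k) := by
    rw [zeta_nat_eq_tsum_of_gt_one hk]
    simpa using hs.hasSum
  have h := HasSum.of_nat_of_neg (f := fun a : ℤ => ((a : ℂ) ^ k)⁻¹) (by simpa using hz)
    (by simpa [he.neg_pow] using hz)
  have h0 : k ≠ 0 := by omega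
  simpa [h0, two_mul] using h

theorem hasSum_int_inv_pow_of_odd {k : ℕ} (hk : 1 < k) (ho : Odd k) :
    HasSum (fun a : ℤ => ((a : ℂ) ^ k)⁻¹) 0 := by
  have hs : Summable fun n : ℕ => ((n : ℂ) ^ k)⁻¹ := 
    Summable.of_norm (by simpa using Real.summable_one_div_nat_pow.2 hk)
  have h := HasSum.of_nat_of_neg (f := fun a : ℤ => ((a : ℂ) ^ k)⁻¹) (by simpa using hs.hasSum)
    (by simpa [ho.neg_pow, inv_neg] using hs.hasSum.neg)
  have h0 : k ≠ 0 := by omega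
  simpa [h0] using h

theorem hasSum_nat_inv_succ_sub_inv :
    HasSum (fun n : ℕ => ((n : ℂ) + 1)⁻¹ - (n : ℂ)⁻¹) 0 := by
  have hs : Summable fun n : ℕ => ((n : ℂ) + 1)⁻¹ - (n : ℂ)⁻¹ := by
    rw [← summable_nat_add_iff 1]
    have hb : Summable fun n : ℕ => 1 / (n : ℝ) ^ 2 :=
      Real.summable_one_div_nat_pow.2 one_lt_two
    refine ((summable_nat_add_iff 1).2 hb).of_norm_bounded fun n => ?_
    have e : (((n + 1 : ℕ) : ℂ) + 1)⁻¹ - ((n + 1 : ℕ) : ℂ)⁻¹ =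
        ((-(1 / ((n + 2) * (n + 1)) : ℝ) : ℝ) : ℂ) := by
      have h1 : ((n : ℂ) + 1) ≠ 0 := by exact_mod_cast n.succ_ne_zero
      have h2 : ((n : ℂ) + 2) ≠ 0 := by exact_mod_cast (n + 1).succ_ne_zero
      have h3 : ((n : ℂ) + 1 + 1) ≠ 0 := by exact_mod_cast (n + 1).succ_ne_zero
      push_cast
      field_simp
      ring
    rw [e, Complex.norm_real, norm_neg, Real.norm_of_nonneg (by positivity)]
    push_cast
    gcongr
    nlinarith [(Nat.cast_nonneg n : (0 : ℝ) ≤ n)]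
  rw [hs.hasSum_iff_tendsto_nat]
  have e (N : ℕ) : ∑ n ∈ range N, (((n : ℂ) + 1)⁻¹ - (n : ℂ)⁻¹) = (N : ℂ)⁻¹ := by
    simpa using sum_range_sub (fun n : ℕ => (n : ℂ)⁻¹) N
  simp_rw [e]
  exact tendsto_inv_atTop_nhds_zero_nat

theorem hasSum_int_inv_add_sub_inv (c : ℕ) :
    HasSum (fun a : ℤ => ((a : ℂ) + c)⁻¹ - (a : ℂ)⁻¹) 0 := by
  induction c with
  | zero => simp
  | succ c ih =>
    have h1 : HasSum (fun a : ℤ => ((a : ℂ) + 1)⁻¹ - (a : ℂ)⁻¹) 0 := by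
      have h := HasSum.of_nat_of_neg_add_one (f := fun a : ℤ => ((a : ℂ) + 1)⁻¹ - (a : ℂ)⁻¹)
        (by simpa using hasSum_nat_inv_succ_sub_inv) (m' := 0) ?_
      · simpa using h
      · convert hasSum_nat_inv_succ_sub_inv using 2 with n
        push_cast
        rw [show -((n : ℂ) + 1) + 1 = -n by ring, inv_neg, inv_neg]
        ring
    have h2 := ((Equiv.addRight (1 : ℤ)).hasSum_iff.2 ih).add h1
    convert h2 using 2 with a
    · simp
      ring_nf
    · simp

theorem hasSum_int_inv_add_inv_sub (c : ℤ) :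
    HasSum (fun a : ℤ => (a : ℂ)⁻¹ + ((c : ℂ) - a)⁻¹) 0 := by
  obtain ⟨n, rfl | rfl⟩ := c.eq_nat_or_neg
  · have h := (Equiv.subRight (n : ℤ)).hasSum_iff.2 (hasSum_int_inv_add_sub_inv n)
    refine h.of_forall_eq (fun a => ?_) rfl
    simp only [Function.comp, Equiv.subRight_apply]
    push_cast
    rw [sub_add_cancel, ← neg_sub, inv_neg, ← sub_eq_add_neg]
  · have h := (hasSum_int_inv_add_sub_inv n).neg
    rw [neg_zero] at h
    refine h.of_forall_eq (fun a => ?_) rfl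
    push_cast
    rw [show (-n - a : ℂ) = -(a + n) by ring, inv_neg]
    ring

theorem hasSum_int_inv_pow_add_inv_pow_sub {k : ℕ} (hk : 1 ≤ k) (c : ℤ) :
    HasSum (fun a : ℤ => ((a : ℂ) ^ k)⁻¹ + (((c : ℂ) - a) ^ k)⁻¹)
      (if Even k then 4 * riemannZeta k else 0) := by
  have shift {s : ℂ} (h : HasSum (fun a : ℤ => ((a : ℂ) ^ k)⁻¹) s) :
      HasSum (fun a : ℤ => (((c : ℂ) - a) ^ k)⁻¹) s := by
    convert (Equiv.subLeft c).hasSum_iff.2 h using 2 with a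
    simp
  split_ifs with he
  · have h := hasSum_int_inv_pow_of_even (by obtain ⟨j, rfl⟩ := he; omega) he
    convert h.add (shift h) using 1
    ring
  · obtain rfl | h1 := hk.eq_or_lt
    · simpa using hasSum_int_inv_add_inv_sub c
    · have h := hasSum_int_inv_pow_of_odd h1 (Nat.not_even_iff_odd.1 he)
      simpa using h.add (shift h)

/-- The inner sum of `∑ 1/(a(c-a)c)^n` over `a`, in which the terms `a = 0` and `a = c` vanish. -/
theorem hasSum_inv_pow_mul_inv_pow_sub {n : ℕ} (hn : 1 ≤ n) {c : ℤ} (hc : c ≠ 0) :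
    HasSum (fun a : ℤ => ((a : ℂ) ^ n)⁻¹ * (((c : ℂ) - a) ^ n)⁻¹)
      (∑ k ∈ range n, ((2 * n - (k + 1) - 1).choose (n - 1) : ℂ) *
        ((c : ℂ) ^ (2 * n - (k + 1)))⁻¹ *
          (if Even (k + 1) then 4 * riemannZeta (k + 1 : ℕ) else 0) -
        2 * ((2 * n - 1).choose (n - 1) : ℂ) * ((c : ℂ) ^ (2 * n))⁻¹) := by
  have hcC : (c : ℂ) ≠ 0 := by exact_mod_cast hc
  set A : ℂ := ((2 * n - 1).choose (n - 1) : ℂ) * ((c : ℂ) ^ (2 * n))⁻¹ with hA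
  have hsum : HasSum (fun a : ℤ => ∑ k ∈ range n, ((2 * n - (k + 1) - 1).choose (n - 1) : ℂ) *
      ((c : ℂ) ^ (2 * n - (k + 1)))⁻¹ * (((a : ℂ) ^ (k + 1))⁻¹ + (((c : ℂ) - a) ^ (k + 1))⁻¹)) _ :=
    hasSum_sum fun k _ => (hasSum_int_inv_pow_add_inv_pow_sub k.succ_pos c).mul_left _
  have edge : ∑ k ∈ range n, ((2 * n - (k + 1) - 1).choose (n - 1) : ℂ) *
      ((c : ℂ) ^ (2 * n - (k + 1)))⁻¹ * ((c : ℂ) ^ (k + 1))⁻¹ = A := by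
    rw [hA, ← sum_choose_two_mul_sub n hn, Nat.cast_sum, sum_mul]
    refine sum_congr rfl fun k hk => ?_
    have := mem_range.1 hk
    rw [mul_assoc, ← mul_inv, ← pow_add, Nat.sub_add_cancel (by omega)]
  refine ((hsum.sub (hasSum_ite_eq (0 : ℤ) A)).sub (hasSum_ite_eq c A)).of_forall_eq
    (fun a => ?_) (by rw [mul_assoc 2, ← hA, sub_sub, two_mul A])
  obtain rfl | ha := eq_or_ne a 0
  · simp [hc.symm, edge, show n ≠ 0 by omega]
  obtain rfl | hac := eq_or_ne a c
  · simp [hc, edge, show n ≠ 0 by omega]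
  · have h := inv_pow_mul_inv_pow_eq_sum n hn (a : ℂ) (c - a) c (by exact_mod_cast ha)
      (sub_ne_zero.2 (by exact_mod_cast hac.symm)) hcC (by ring)
    simp [ha, hac, h]

theorem hasSum_int_sum_inv_pow {n : ℕ} (hn : 1 ≤ n) (he : Even n) :
    HasSum (fun c : ℤ => ((c : ℂ) ^ n)⁻¹ *
      (∑ k ∈ range n, ((2 * n - (k + 1) - 1).choose (n - 1) : ℂ) *
        ((c : ℂ) ^ (2 * n - (k + 1)))⁻¹ *
          (if Even (k + 1) then 4 * riemannZeta (k + 1 : ℕ) else 0) -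
        2 * ((2 * n - 1).choose (n - 1) : ℂ) * ((c : ℂ) ^ (2 * n))⁻¹))
      (8 * ∑ i ∈ (range (n + 1)).filter (fun i => Even i),
        ((2 * n - i - 1).choose (n - 1) : ℂ) * riemannZeta i * riemannZeta (3 * n - i : ℕ)) := by
  have h1 : HasSum (fun c : ℤ => ∑ k ∈ range n, ((2 * n - (k + 1) - 1).choose (n - 1) : ℂ) *
      (if Even (k + 1) then 4 * riemannZeta (k + 1 : ℕ) * ((c : ℂ) ^ (3 * n - (k + 1)))⁻¹ else 0))
      (∑ k ∈ range n, ((2 * n - (k + 1) - 1).choose (n - 1) : ℂ) *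
        (if Even (k + 1) then 4 * riemannZeta (k + 1 : ℕ) *
          (2 * riemannZeta (3 * n - (k + 1) : ℕ)) else 0)) := by
    refine hasSum_sum fun k hk => HasSum.mul_left _ ?_
    have hk := mem_range.1 hk
    split_ifs with hk2
    · refine (hasSum_int_inv_pow_of_even (by omega) ?_).mul_left _
      exact (Nat.even_sub (by omega)).2 (by simp [he.mul_left, hk2])
    · exact hasSum_zero
  have h2 := (hasSum_int_inv_pow_of_even (k := 3 * n) (by omega) (he.mul_left 3)).mul_left
    (2 * ((2 * n - 1).choose (n - 1) : ℂ))
  refine (h1.sub h2).of_forall_eq (fun c => ?_) ?_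
  · rw [mul_sub, mul_sum]
    congr 1
    · refine sum_congr rfl fun k hk => ?_
      have hk := mem_range.1 hk
      rw [show 3 * n - (k + 1) = n + (2 * n - (k + 1)) by omega, pow_add, mul_inv]
      split_ifs <;> ring
    · rw [show 3 * n = n + 2 * n by ring, pow_add, mul_inv]
      ring
  · rw [sum_filter, sum_range_succ']
    simp only [Even.zero, if_true, Nat.cast_zero, riemannZeta_zero, Nat.sub_zero, mul_add, mul_sum]
    rw [sub_eq_add_neg]
    congr 1
    · refine sum_congr rfl fun k _ => ?_
      split_ifs <;> ring
    · ring

/-- The six sign and order patterns of a triple of nonzero integers summing to zero. -/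
def signedPair : Fin 6 × (ℕ+ × ℕ+) → ℤ × ℤ
  | (0, a, b) => (a + b, a)
  | (1, a, b) => (-(a + b), -a)
  | (2, a, b) => (a, a + b)
  | (3, a, b) => (-a, -(a + b))
  | (4, a, b) => (a, -b)
  | (5, a, b) => (-a, b)

theorem signedPair_injective : Function.Injective signedPair := by
  rintro ⟨i, a, b⟩ ⟨j, a', b'⟩ h
  have := a.pos
  have := b.pos
  have := a'.pos
  have := b'.pos
  fin_cases i <;> fin_cases j <;>
    simp only [signedPair, Prod.mk.injEq, Fin.reduceFinMk, Fin.zero_eta, Fin.mk_one, true_and,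
      ← PNat.coe_inj] at h ⊢ <;> omega

theorem mem_range_signedPair {c a : ℤ} (hc : c ≠ 0) (ha : a ≠ 0) (hac : c - a ≠ 0) :
    (c, a) ∈ Set.range signedPair := by
  have lift {x : ℤ} (hx : 0 < x) : ∃ p : ℕ+, (p : ℤ) = x :=
    ⟨⟨x.toNat, by omega⟩, by simp; omega⟩
  obtain h1 | h1 := hc.lt_or_gt <;> obtain h2 | h2 := ha.lt_or_gt <;>
    obtain h3 | h3 := hac.lt_or_gt
  · obtain ⟨p, hp⟩ := lift (neg_pos.2 h2)
    obtain ⟨q, hq⟩ := lift (neg_pos.2 h3)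
    exact ⟨(1, p, q), by simp [signedPair]; omega⟩
  · obtain ⟨p, hp⟩ := lift (neg_pos.2 h1)
    obtain ⟨q, hq⟩ := lift h3
    exact ⟨(3, p, q), by simp [signedPair]; omega⟩
  · obtain ⟨p, hp⟩ := lift (neg_pos.2 h1)
    obtain ⟨q, hq⟩ := lift h2
    exact ⟨(5, p, q), by simp [signedPair]; omega⟩
  · omega
  · omega
  · obtain ⟨p, hp⟩ := lift h1
    obtain ⟨q, hq⟩ := lift (neg_pos.2 h2)
    exact ⟨(4, p, q), by simp [signedPair]; omega⟩
  · obtain ⟨p, hp⟩ := lift h1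
    obtain ⟨q, hq⟩ := lift (neg_pos.2 h3)
    exact ⟨(2, p, q), by simp [signedPair]; omega⟩
  · obtain ⟨p, hp⟩ := lift h2
    obtain ⟨q, hq⟩ := lift h3
    exact ⟨(0, p, q), by simp [signedPair]; omega⟩

theorem hasSum_int_prod_of_pnat {n : ℕ} (hn : 1 ≤ n) (he : Even n) {T : ℂ}
    (hT : HasSum (fun p : ℕ+ × ℕ+ =>
      ((((p.1 : ℂ) * p.2 * (p.1 + p.2)) ^ n)⁻¹)) T) :
    HasSum (fun p : ℤ × ℤ => ((p.1 : ℂ) ^ n)⁻¹ *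
      (((p.2 : ℂ) ^ n)⁻¹ * (((p.1 : ℂ) - p.2) ^ n)⁻¹)) (6 * T) := by
  have h6 : HasSum (fun q : Fin 6 × (ℕ+ × ℕ+) =>
      (((q.2.1 : ℂ) * q.2.2 * (q.2.1 + q.2.2)) ^ n)⁻¹) (6 * T) := by
    have hc : HasSum (fun _ : Fin 6 => (1 : ℂ)) 6 := by
      simpa using hasSum_fintype fun _ : Fin 6 => (1 : ℂ)
    have hs := summable_mul_of_summable_norm hc.summable.norm hT.summable.norm
    have h := hc.mul hT hs
    simpa only [one_mul] using h
  rw [← signedPair_injective.hasSum_iff]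
  · convert h6 using 1
    ext ⟨i, a, b⟩
    simp only [← mul_inv, ← mul_pow, Function.comp]
    refine inv_inj.2 ?_
    fin_cases i <;> dsimp only [signedPair] <;>
      push_cast <;> first
      | (congr 1; ring1)
      | (rw [← he.neg_pow]; congr 1; ring1)
  · rintro ⟨c, a⟩ h
    have hn0 : n ≠ 0 := by omega
    by_contra h0
    refine h (mem_range_signedPair ?_ ?_ ?_)
    · rintro rfl; simp [hn0] at h0
    · rintro rfl; simp [hn0] at h0
    · intro hca
      obtain rfl : c = a := by omega
      simp [hn0] at h0

/-- Special values of the Witten zeta function of `𝔰𝔩₃` at even integers: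
`6 ∑_{a,b ≥ 1} 1/(ab(a+b))^{2m} = 8 ∑_{0 ≤ i ≤ 2m, i even} C(4m−i−1, 2m−1) ζ(i) ζ(6m−i)`,
the series on the left converging absolutely. -/
theorem witten_sl3_even_values (m : ℕ) (hm : 1 ≤ m) :
    (Summable fun p : ℕ+ × ℕ+ =>
      1 / (((p.1 * p.2 * (p.1 + p.2) : ℕ+) : ℕ) : ℝ) ^ (2 * m)) ∧
    (6 : ℂ) * ((∑' p : ℕ+ × ℕ+,
        1 / (((p.1 * p.2 * (p.1 + p.2) : ℕ+) : ℕ) : ℝ) ^ (2 * m) : ℝ) : ℂ) =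
      8 * ∑ i ∈ (Finset.range (2 * m + 1)).filter (fun i => Even i),
        ((4 * m - i - 1).choose (2 * m - 1) : ℂ) *
          riemannZeta (i : ℂ) * riemannZeta (((6 * m - i : ℕ) : ℂ)) := by
  have hsum : Summable fun p : ℕ+ × ℕ+ =>
      1 / (((p.1 * p.2 * (p.1 + p.2) : ℕ+) : ℕ) : ℝ) ^ (2 * m) := by
    have h1 : Summable fun a : ℕ+ => 1 / ((a : ℕ) : ℝ) ^ (2 * m) :=
      (Real.summable_one_div_nat_pow.2 (by omega : 1 < 2 * m)).comp_injective PNat.coe_injective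
    refine (h1.mul_of_nonneg h1 (fun _ => by positivity) fun _ => by positivity).of_nonneg_of_le
      (fun _ => by positivity) fun p => ?_
    have ha : (1 : ℝ) ≤ (p.1 : ℕ) := by exact_mod_cast p.1.pos
    have hb : (1 : ℝ) ≤ (p.2 : ℕ) := by exact_mod_cast p.2.pos
    rw [one_div_mul_one_div, ← mul_pow]
    push_cast
    exact one_div_le_one_div_of_le (by positivity) (pow_le_pow_left₀ (by positivity)
      (le_mul_of_one_le_right (by positivity) (by linarith)) _)
  refine ⟨hsum, ?_⟩
  have hn : 1 ≤ 2 * m := by omega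
  have he : Even (2 * m) := even_two_mul m
  have hT := Complex.hasSum_ofReal.2 hsum.hasSum
  have hT' : HasSum (fun p : ℕ+ × ℕ+ => (((p.1 : ℂ) * p.2 * (p.1 + p.2)) ^ (2 * m))⁻¹) _ :=
    hT.of_forall_eq (fun p => by push_cast; rw [one_div]) rfl
  have h := hasSum_int_prod_of_pnat hn he hT'
  rw [show 4 * m = 2 * (2 * m) by ring, show 6 * m = 3 * (2 * m) by ring]
  refine HasSum.unique (h.prod_fiberwise fun c => ?_) (hasSum_int_sum_inv_pow hn he)
  obtain rfl | hc := eq_or_ne c 0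
  · simp [show m ≠ 0 by omega, hasSum_zero]
  · exact (hasSum_inv_pow_mul_inv_pow_sub hn hc).mul_left (((c : ℂ) ^ (2 * m))⁻¹)
end

section
/- For every integer m ≥ 1, 24 · Σ_{a,b,c ≥ 1} 1/(a·b·c·(a+b)·(b+c)·(a+b+c))^{2m} = 16 · Σ_{i=0}^{2m} C(4m−i−1, 2m−1) · (A_i + B_i + C_i + D_i), where the triple sum ranges over all triples of positive integers (a, b, c) and converges absolutely, and where: A_i = Σ_{0 ≤ j ≤ 2m, 0 ≤ t ≤ 4m+i−j, j and t even} C(2m+i−j−1, i−1) C(6m+i−j−t−1, 2m−1) ζ(j) ζ(t) ζ(12m−j−t); B_i = Σ_{0 ≤ j ≤ 2m, 0 ≤ u ≤ 2m, j and u even} C(2m+i−j−1, i−1) C(6m+i−j−u−1, 4m+i−j−1) ζ(j) ζ(u) ζ(12m−j−u); C_i = Σ_{0 ≤ k ≤ i, 0 ≤ v ≤ 4m+i−k, k and v even} C(2m+i−k−1, i−k) C(6m+i−k−v−1, 2m−1) ζ(k) ζ(v) ζ(12m−k−v); D_i = Σ_{0 ≤ k ≤ i, 0 ≤ w ≤ 2m,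 k and w even} C(2m+i−k−1, i−k) C(6m+i−k−w−1, 4m+i−k−1) ζ(k) ζ(w) ζ(12m−k−w). Equivalently, the left-hand side equals (24/12^{2m}) ζ_{𝔰𝔩₄}(2m), where ζ_{𝔰𝔩₄}(s) = Σ_{a,b,c ≥ 1} (a b c (a+b)(b+c)(a+b+c)/12)^{−s} is the Witten zeta function of 𝔰𝔩₄. -/
open Finset

/-- `A_i` in the `𝔰𝔩₄` evaluation. Binomial coefficients `C(p,q)` with `q < 0`
(which occurs in `C(2m+i−j−1, i−1)` when `i = 0`) are interpreted as `0`. -/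
noncomputable def wittenSl4A (m i : ℕ) : ℂ :=
  ∑ j ∈ (range (2 * m + 1)).filter (fun j => Even j),
    ∑ t ∈ (range (4 * m + i - j + 1)).filter (fun t => Even t),
      ((if i = 0 then 0 else (2 * m + i - j - 1).choose (i - 1) : ℕ) : ℂ) *
        ((6 * m + i - j - t - 1).choose (2 * m - 1) : ℂ) *
        riemannZeta (j : ℂ) * riemannZeta (t : ℂ) *
        riemannZeta (((12 * m - j - t : ℕ) : ℂ))

/-- `B_i` in the `𝔰𝔩₄` evaluation. -/
noncomputable def wittenSl4B (m i : ℕ) : ℂ :=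
  ∑ j ∈ (range (2 * m + 1)).filter (fun j => Even j),
    ∑ u ∈ (range (2 * m + 1)).filter (fun u => Even u),
      ((if i = 0 then 0 else (2 * m + i - j - 1).choose (i - 1) : ℕ) : ℂ) *
        ((6 * m + i - j - u - 1).choose (4 * m + i - j - 1) : ℂ) *
        riemannZeta (j : ℂ) * riemannZeta (u : ℂ) *
        riemannZeta (((12 * m - j - u : ℕ) : ℂ))

/-- `C_i` in the `𝔰𝔩₄` evaluation. -/
noncomputable def wittenSl4C (m i : ℕ) : ℂ :=
  ∑ k ∈ (range (i + 1)).filter (fun k => Even k),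
    ∑ v ∈ (range (4 * m + i - k + 1)).filter (fun v => Even v),
      ((2 * m + i - k - 1).choose (i - k) : ℂ) *
        ((6 * m + i - k - v - 1).choose (2 * m - 1) : ℂ) *
        riemannZeta (k : ℂ) * riemannZeta (v : ℂ) *
        riemannZeta (((12 * m - k - v : ℕ) : ℂ))

/-- `D_i` in the `𝔰𝔩₄` evaluation. -/
noncomputable def wittenSl4D (m i : ℕ) : ℂ :=
  ∑ k ∈ (range (i + 1)).filter (fun k => Even k),
    ∑ w ∈ (range (2 * m + 1)).filter (fun w => Even w),
      ((2 * m + i - k - 1).choose (i - k) : ℂ) *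
        ((6 * m + i - k - w - 1).choose (4 * m + i - k - 1) : ℂ) *
        riemannZeta (k : ℂ) * riemannZeta (w : ℂ) *
        riemannZeta (((12 * m - k - w : ℕ) : ℂ))

/-- The integer sum `∑_{a ≠ 0} a⁻ᵏ`, regularised to `2 ζ(0) = -1` at `k = 0`. -/
noncomputable def intZeta (k : ℕ) : ℂ := if Even k then 2 * riemannZeta k else 0

/-- The summand of `intZeta`. -/
noncomputable def intZetaTerm (a : ℤ) (k : ℕ) : ℂ :=
  if k = 0 then (if a = 0 then -1 else 0) else ((a : ℂ)⁻¹) ^ k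

/-- Half of a partial fraction expansion. -/
noncomputable def pfSum (w : ℂ) (p q : ℕ) (φ : ℕ → ℂ) : ℂ :=
  ∑ k ∈ range (p + 1), ((p + q - k - 1).choose (q - 1) : ℂ) * φ k * w ^ (p + q - k)

lemma pfSum_succ_succ (w : ℂ) {p q : ℕ} (hq : 1 ≤ q) (φ : ℕ → ℂ) :
    pfSum w (p + 1) (q + 1) φ = w * (pfSum w (p + 1) q φ + pfSum w p (q + 1) φ) := by
  obtain ⟨q, rfl⟩ := Nat.exists_eq_add_of_le' hq
  unfold pfSum
  rw [sum_range_succ _ (p + 1), sum_range_succ _ (p + 1), mul_add, mul_add, mul_sum, mul_sum,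
    add_right_comm (∑ k ∈ range (p + 1), w * _), ← sum_add_distrib]
  congr 1
  · refine sum_congr rfl fun k hk => ?_
    obtain ⟨d, rfl⟩ := Nat.exists_eq_add_of_le (Nat.lt_succ_iff.mp (mem_range.mp hk))
    rw [show k + d + 1 + (q + 1 + 1) - k - 1 = (q + d + 1) + 1 by omega,
      show k + d + 1 + (q + 1) - k - 1 = q + d + 1 by omega,
      show k + d + (q + 1 + 1) - k - 1 = q + d + 1 by omega,
      show k + d + 1 + (q + 1 + 1) - k = (q + d + 2) + 1 by omega,
      show k + d + 1 + (q + 1) - k = q + d + 2 by omega,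
      show k + d + (q + 1 + 1) - k = q + d + 2 by omega]
    simp only [Nat.add_sub_cancel]
    rw [Nat.choose_succ_succ]
    push_cast
    ring
  · rw [show p + 1 + (q + 1 + 1) - (p + 1) - 1 = q + 1 by omega,
      show p + 1 + (q + 1) - (p + 1) - 1 = q by omega,
      show p + 1 + (q + 1 + 1) - (p + 1) = (q + 1) + 1 by omega,
      show p + 1 + (q + 1) - (p + 1) = q + 1 by omega]
    simp only [Nat.add_sub_cancel, Nat.choose_self]
    ring

lemma pfSum_succ_one (w : ℂ) (p : ℕ) (φ : ℕ → ℂ) :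
    pfSum w (p + 1) 1 φ = w * (φ (p + 1) + pfSum w p 1 φ) := by
  unfold pfSum
  rw [sum_range_succ, mul_add, mul_sum, add_comm]
  congr 1
  · simp [mul_comm]
  · refine sum_congr rfl fun k hk => ?_
    rw [show p + 1 + 1 - k = (p + 1 - k) + 1 by have := mem_range.mp hk; omega]
    simp
    ring

lemma pfSum_one_succ (w : ℂ) (p : ℕ) {φ : ℕ → ℂ} (h : φ 0 = 0) :
    pfSum w 1 (p + 1) φ = φ 1 * w ^ (p + 1) := by
  simp [pfSum, sum_range_succ, h]

/-- Partial fractions for `xᵖ y^q`, where `x y = (x + y) w`. -/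
lemma pow_mul_pow_eq_pfSum {x y w : ℂ} (h : x * y = w * (x + y)) {p q : ℕ} (hp : 1 ≤ p)
    (hq : 1 ≤ q) :
    x ^ p * y ^ q = pfSum w p q (fun k => if k = 0 then 0 else x ^ k) +
      pfSum w q p (fun k => if k = 0 then 0 else y ^ k) := by
  have base : ∀ (x y : ℂ), x * y = w * (x + y) → ∀ p, 1 ≤ p →
      x ^ p * y = pfSum w p 1 (fun k => if k = 0 then 0 else x ^ k) +
      pfSum w 1 p (fun k => if k = 0 then 0 else y ^ k) := by
    intro x y h p hp
    induction p, hp using Nat.le_induction with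
    | base => simp [pfSum, sum_range_succ, h]; ring
    | succ p hp ih =>
      obtain ⟨p, rfl⟩ := Nat.exists_eq_add_of_le' hp
      rw [pfSum_one_succ _ _ (by simp)] at ih ⊢
      rw [pfSum_succ_one]
      rw [show x ^ (p + 1 + 1) * y = x ^ (p + 1) * (x * y) by ring, h,
        show x ^ (p + 1) * (w * (x + y)) = w * x ^ (p + 2) + w * (x ^ (p + 1) * y) by ring, ih]
      simp only [Nat.add_eq_zero_iff, one_ne_zero, and_false, if_false]
      ring
  induction q, hq using Nat.le_induction generalizing p with
  | base => simpa using base x y h p hp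
  | succ q hq ihq =>
    induction p, hp using Nat.le_induction with
    | base =>
      rw [add_comm (pfSum _ _ _ _), ← base y x (by rw [mul_comm, h, add_comm]) (q + 1) (by omega)]
      ring
    | succ p hp ihp =>
      rw [pfSum_succ_succ w hq, pfSum_succ_succ w hp,
        show x ^ (p + 1) * y ^ (q + 1) = x ^ p * y ^ q * (x * y) by ring, h,
        show x ^ p * y ^ q * (w * (x + y)) = w * (x ^ (p + 1) * y ^ q + x ^ p * y ^ (q + 1)) by ring,
        ihp, ihq (p := p + 1) (by omega)]
      ring

lemma sum_range_add_choose_self (p q : ℕ) :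
    ∑ k ∈ range q, (p + k).choose p = (p + q).choose (p + 1) := by
  induction q with
  | zero => simp
  | succ q ih => rw [sum_range_succ, ih, ← add_assoc, Nat.choose_succ_succ, add_comm]

/-- The partial fraction coefficients in one variable add up to the constant coefficient in the
other one. -/
lemma pfSum_pow {p q : ℕ} (hp : 1 ≤ p) (hq : 1 ≤ q) (w : ℂ) :
    pfSum w q p (fun k => if k = 0 then 0 else w ^ k) =
      ((p + q - 1).choose (q - 1) : ℂ) * w ^ (p + q) := by
  obtain ⟨p, rfl⟩ := Nat.exists_eq_add_of_le' hp
  obtain ⟨q, rfl⟩ := Nat.exists_eq_add_of_le' hq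
  unfold pfSum
  rw [sum_range_succ', ← sum_range_reflect]
  simp only [if_true, mul_zero, zero_mul, add_zero, Nat.add_sub_cancel]
  have : (p + 1 + (q + 1) - 1).choose q = ∑ k ∈ range (q + 1), (p + k).choose p := by
    rw [sum_range_add_choose_self, ← Nat.choose_symm (by omega)]
    congr 1 <;> omega
  rw [this, Nat.cast_sum, sum_mul]
  refine sum_congr rfl fun k hk => ?_
  have := mem_range.mp hk
  rw [if_neg (by omega), mul_assoc, ← pow_add,
    show q + 1 + (p + 1) - (q - k + 1) - 1 = p + k by omega,
    show q - k + 1 + (q + 1 + (p + 1) - (q - k + 1)) = p + 1 + (q + 1) by omega]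

lemma inv_pow_mul_inv_pow_eq_pfSum {p q : ℕ} (hp : 1 ≤ p) (hq : 1 ≤ q) {x : ℤ} (hx : x ≠ 0)
    (a : ℤ) :
    ((a : ℂ)⁻¹) ^ p * (((x - a : ℤ) : ℂ)⁻¹) ^ q =
      pfSum (x : ℂ)⁻¹ p q (intZetaTerm a) + pfSum (x : ℂ)⁻¹ q p (intZetaTerm (x - a)) := by
  have zero_case : ∀ {p q : ℕ}, 1 ≤ p → 1 ≤ q →
      pfSum (x : ℂ)⁻¹ p q (intZetaTerm 0) + pfSum (x : ℂ)⁻¹ q p (intZetaTerm x) = 0 := by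
    intro p q hp hq
    have h1 : pfSum (x : ℂ)⁻¹ q p (intZetaTerm x) = _ :=
      (congrArg (pfSum (x : ℂ)⁻¹ q p) (by ext k; simp [intZetaTerm, hx])).trans
        (pfSum_pow hp hq (x : ℂ)⁻¹)
    rw [h1, pfSum, sum_range_succ', sum_eq_zero]
    · simp [intZetaTerm]
    · intro k _
      simp [intZetaTerm]
  by_cases ha : a = 0
  · subst ha
    simp [zero_case hp hq, zero_pow (by omega : p ≠ 0)]
  by_cases hxa : x - a = 0
  · obtain rfl : x = a := by omega
    rw [sub_self, add_comm, zero_case hq hp]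
    simp [zero_pow (by omega : q ≠ 0)]
  · have hx' : (x : ℂ) ≠ 0 := by exact_mod_cast hx
    have ha' : (a : ℂ) ≠ 0 := by exact_mod_cast ha
    have hxa' : ((x - a : ℤ) : ℂ) ≠ 0 := by exact_mod_cast hxa
    rw [pow_mul_pow_eq_pfSum (w := (x : ℂ)⁻¹) _ hp hq]
    · congr 2 <;> ext k <;> simp [intZetaTerm, ha, hxa]
    · field_simp
      push_cast
      ring

lemma intZeta_zero : intZeta 0 = -1 := by
  norm_num [intZeta, riemannZeta_zero]

lemma HasSum.of_eq {α β : Type*} [AddCommMonoid β] [TopologicalSpace β] {f g : α → β} {s t : β}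
    (h : HasSum f s) (hf : ∀ x, g x = f x) (hs : t = s) : HasSum g t := by
  rw [hs, funext hf]
  exact h

lemma intZeta_one : intZeta 1 = 0 := by
  simp [intZeta]

lemma hasSum_inv_pow_int {k : ℕ} (hk : 2 ≤ k) :
    HasSum (fun a : ℤ => ((a : ℂ)⁻¹) ^ k) (intZeta k) := by
  have h : HasSum (fun n : ℕ => ((n : ℂ)⁻¹) ^ k) (riemannZeta k) := by
    rw [zeta_nat_eq_tsum_of_gt_one (by omega)]
    simp only [inv_pow, one_div]
    have := Complex.summable_ofReal.mpr ((Real.summable_nat_pow_inv (p := k)).mpr (by omega))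
    push_cast at this
    exact this.hasSum
  have h' : HasSum (fun n : ℕ => (((-n : ℤ) : ℂ)⁻¹) ^ k) ((-1) ^ k * riemannZeta k) := by
    refine (h.mul_left ((-1 : ℂ) ^ k)).of_eq (fun n => ?_) rfl
    rw [← mul_pow]
    push_cast
    rw [inv_neg, neg_one_mul]
  have := HasSum.of_nat_of_neg (f := fun a : ℤ => ((a : ℂ)⁻¹) ^ k) (by simpa using h) h'
  refine this.of_eq (fun _ => rfl) ?_
  rcases Nat.even_or_odd k with hk' | hk'
  · simp [intZeta, hk', hk'.neg_one_pow, show k ≠ 0 by omega]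
    ring
  · simp [intZeta, Nat.not_even_iff_odd.mpr hk', hk'.neg_one_pow, show k ≠ 0 by omega]

lemma hasSum_intZetaTerm {k : ℕ} (hk : k ≠ 1) :
    HasSum (fun a : ℤ => intZetaTerm a k) (intZeta k) := by
  by_cases h0 : k = 0
  · subst h0
    simpa [intZetaTerm, intZeta_zero] using hasSum_ite_eq (0 : ℤ) (-1 : ℂ)
  · simpa [intZetaTerm, h0] using hasSum_inv_pow_int (k := k) (by omega)

lemma hasSum_inv_sub_inv_succ :
    HasSum (fun n : ℕ => ((n + 2 : ℂ))⁻¹ - ((n + 1 : ℂ))⁻¹) (-1) := by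
  have h : HasSum (fun n : ℕ => ((n + 1 : ℝ))⁻¹ - ((n + 2 : ℝ))⁻¹) 1 := by
    rw [hasSum_iff_tendsto_nat_of_nonneg]
    · have : ∀ N : ℕ, ∑ n ∈ range N, (((n + 1 : ℝ))⁻¹ - ((n + 2 : ℝ))⁻¹) = 1 - 1 / ((N : ℝ) + 1) := by
        intro N
        induction N with
        | zero => simp
        | succ N ih =>
          rw [sum_range_succ, ih]
          push_cast
          ring
      simp only [this]
      simpa using tendsto_one_div_add_atTop_nhds_zero_nat (𝕜 := ℝ) |>.const_sub 1
    · intro n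
      rw [sub_nonneg]
      gcongr
      norm_num
  refine (Complex.hasSum_ofReal.mpr h).neg.of_eq (fun n => ?_) ?_
  · push_cast
    ring
  · simp

lemma hasSum_inv_sub_inv_pred :
    HasSum (fun a : ℤ => (a : ℂ)⁻¹ - ((a - 1 : ℤ) : ℂ)⁻¹) 0 := by
  have h1 : HasSum (fun n : ℕ => (((n : ℤ) : ℂ))⁻¹ - (((n : ℤ) - 1 : ℤ) : ℂ)⁻¹) 1 := by
    rw [← hasSum_nat_add_iff' 2]
    refine hasSum_inv_sub_inv_succ.of_eq (fun n => ?_) ?_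
    · push_cast
      ring_nf
    · norm_num [sum_range_succ]
  have h2 : HasSum (fun n : ℕ => ((-((n : ℤ) + 1) : ℤ) : ℂ)⁻¹ -
      ((-((n : ℤ) + 1) - 1 : ℤ) : ℂ)⁻¹) (-1) := by
    refine hasSum_inv_sub_inv_succ.of_eq (fun n => ?_) rfl
    push_cast
    rw [show (-((n : ℂ) + 1) - 1) = -(n + 2) by ring, inv_neg, inv_neg]
    ring
  simpa using HasSum.of_nat_of_neg_add_one
    (f := fun a : ℤ => (a : ℂ)⁻¹ - ((a - 1 : ℤ) : ℂ)⁻¹) h1 h2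

lemma hasSum_inv_add_inv_sub (x : ℤ) :
    HasSum (fun a : ℤ => (a : ℂ)⁻¹ + ((x - a : ℤ) : ℂ)⁻¹) 0 := by
  induction x using Int.induction_on with
  | zero => simp [inv_neg, hasSum_zero]
  | succ x ih =>
    have h := ih.add ((Equiv.subLeft ((x : ℤ) + 1)).hasSum_iff.mpr hasSum_inv_sub_inv_pred)
    refine h.of_eq (fun a => ?_) (by simp)
    · simp only [Function.comp_apply, Equiv.subLeft_apply]
      rw [show (x : ℤ) + 1 - a - 1 = x - a by ring]
      ring
  | pred x ih =>
    have h := ih.sub ((Equiv.subLeft (-(x : ℤ))).hasSum_iff.mpr hasSum_inv_sub_inv_pred)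
    refine h.of_eq (fun a => ?_) (by simp)
    · simp only [Function.comp_apply, Equiv.subLeft_apply]
      rw [show -(x : ℤ) - 1 - a = -x - a - 1 by ring]
      ring

lemma pfSum_eq_pfSum_update (w : ℂ) {p : ℕ} (hp : 1 ≤ p) (q : ℕ) (φ : ℕ → ℂ) :
    pfSum w p q φ = pfSum w p q (Function.update φ 1 0) +
      ((p + q - 2).choose (q - 1) : ℂ) * w ^ (p + q - 1) * φ 1 := by
  have h : (1 : ℕ) ∈ range (p + 1) := by simp; omega
  unfold pfSum
  rw [← add_sum_erase _ _ h, ← add_sum_erase _ (fun k => _ * Function.update φ 1 0 k * _) h,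
    add_comm, sum_congr rfl fun k hk => by rw [← Function.update_of_ne (ne_of_mem_erase hk) 0 φ]]
  simp [Nat.sub_sub]
  ring

lemma hasSum_pfSum_update (w : ℂ) (p q : ℕ) :
    HasSum (fun a : ℤ => pfSum w p q (Function.update (intZetaTerm a) 1 0))
      (pfSum w p q intZeta) := by
  refine hasSum_sum fun k _ => HasSum.mul_right _ (HasSum.mul_left _ ?_)
  by_cases hk : k = 1
  · subst hk
    simp [intZeta_one, hasSum_zero]
  · simpa [Function.update_of_ne hk] using hasSum_intZetaTerm hk

/-- `∑_a a⁻ᵖ (x - a)^(-q)` in terms of zeta values. -/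
lemma hasSum_inv_pow_mul_inv_pow {p q : ℕ} (hp : 1 ≤ p) (hq : 1 ≤ q) {x : ℤ} (hx : x ≠ 0) :
    HasSum (fun a : ℤ => ((a : ℂ)⁻¹) ^ p * (((x - a : ℤ) : ℂ)⁻¹) ^ q)
      (pfSum (x : ℂ)⁻¹ p q intZeta + pfSum (x : ℂ)⁻¹ q p intZeta) := by
  simp only [inv_pow_mul_inv_pow_eq_pfSum hp hq hx]
  have h := ((hasSum_pfSum_update (x : ℂ)⁻¹ p q).add ((Equiv.subLeft x).hasSum_iff.mpr
    (hasSum_pfSum_update (x : ℂ)⁻¹ q p))).add ((hasSum_inv_add_inv_sub x).mul_left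
      (((p + q - 2).choose (q - 1) : ℂ) * (x : ℂ)⁻¹ ^ (p + q - 1)))
  rw [mul_zero, add_zero] at h
  refine h.congr_fun fun a => ?_
  have hc : (q + p - 2).choose (p - 1) = (p + q - 2).choose (q - 1) := by
    rw [← Nat.choose_symm (by omega)]
    congr 1 <;> omega
  rw [pfSum_eq_pfSum_update _ hp q, pfSum_eq_pfSum_update _ hq p, hc, add_comm q p]
  simp only [Function.comp_apply, Equiv.subLeft_apply, intZetaTerm]
  simp
  ring

/-- The value of `∑_a intZetaTerm a i * (R - a)⁻ⁿ` in terms of `w = R⁻¹`. -/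
noncomputable def innerSum (w : ℂ) (n i : ℕ) : ℂ :=
  pfSum w i n intZeta + if i = 0 then 0 else pfSum w n i intZeta

lemma hasSum_intZetaTerm_mul {n : ℕ} (hn : 1 ≤ n) (i : ℕ) {R : ℤ} (hR : R ≠ 0) :
    HasSum (fun a : ℤ => intZetaTerm a i * (((R - a : ℤ) : ℂ)⁻¹) ^ n)
      (innerSum (R : ℂ)⁻¹ n i) := by
  by_cases hi : i = 0
  · subst hi
    have h := hasSum_ite_eq (0 : ℤ) (-((R : ℂ)⁻¹) ^ n)
    refine h.of_eq (fun a => ?_) ?_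
    · by_cases ha : a = 0 <;> simp [intZetaTerm, ha]
    · simp [innerSum, pfSum, intZeta_zero]
  · simpa [intZetaTerm, innerSum, hi] using hasSum_inv_pow_mul_inv_pow (p := i) (by omega) hn hR

lemma hasSum_triple {n : ℕ} (hn : 1 ≤ n) (he : Even n) {z R : ℤ} (hz : z ≠ 0) (hR : R ≠ 0)
    (hzR : z - R ≠ 0) :
    HasSum (fun a : ℤ => ((a : ℂ)⁻¹) ^ n * (((z - a : ℤ) : ℂ)⁻¹) ^ n * (((R - a : ℤ) : ℂ)⁻¹) ^ n)
      (pfSum (z : ℂ)⁻¹ n n fun i => innerSum (R : ℂ)⁻¹ n i + innerSum ((z - R : ℤ) : ℂ)⁻¹ n i) := by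
  have h : ∀ i, HasSum (fun a : ℤ => (intZetaTerm a i + intZetaTerm (z - a) i) *
      (((R - a : ℤ) : ℂ)⁻¹) ^ n) (innerSum (R : ℂ)⁻¹ n i + innerSum ((z - R : ℤ) : ℂ)⁻¹ n i) := by
    intro i
    have h := (hasSum_intZetaTerm_mul hn i hR).add ((Equiv.subLeft z).hasSum_iff.mpr
      (hasSum_intZetaTerm_mul hn i hzR))
    refine h.congr_fun fun a => ?_
    simp only [Function.comp_apply, Equiv.subLeft_apply]
    rw [show z - R - (z - a) = -(R - a) by ring, Int.cast_neg, inv_neg, he.neg_pow]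
    ring
  have h2 : HasSum _ (pfSum (z : ℂ)⁻¹ n n fun i =>
    innerSum (R : ℂ)⁻¹ n i + innerSum ((z - R : ℤ) : ℂ)⁻¹ n i) :=
    hasSum_sum fun k _ => HasSum.mul_right _ (HasSum.mul_left _ (h k))
  refine h2.congr_fun fun a => ?_
  rw [inv_pow_mul_inv_pow_eq_pfSum hn hn hz, pfSum, pfSum, ← sum_add_distrib, sum_mul]
  refine sum_congr rfl fun k _ => ?_
  ring

/-- `∑_z z⁻ᵉ ∑_R R⁻ᵖ (z - R)^(-q)` in terms of zeta values. -/
noncomputable def zetaProdSum (e p q : ℕ) : ℂ :=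
  (∑ t ∈ range (p + 1), ((p + q - t - 1).choose (q - 1) : ℂ) * intZeta t *
    intZeta (e + (p + q - t))) +
  ∑ t ∈ range (q + 1), ((q + p - t - 1).choose (p - 1) : ℂ) * intZeta t *
    intZeta (e + (q + p - t))

/-- `innerSum`, with the powers of `w` replaced by the values of a function. -/
noncomputable def innerSumWith (g : ℕ → ℂ) (n i : ℕ) : ℂ :=
  (∑ k ∈ range (i + 1), ((i + n - k - 1).choose (n - 1) : ℂ) * intZeta k * g (i + n - k)) +
    if i = 0 then 0 else
      ∑ k ∈ range (n + 1), ((n + i - k - 1).choose (i - 1) : ℂ) * intZeta k * g (n + i - k)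

lemma innerSum_eq (w : ℂ) (n i : ℕ) : innerSum w n i = innerSumWith (fun s => w ^ s) n i := rfl

lemma hasSum_innerSumWith {ι : Type*} {g : ι → ℕ → ℂ} {h : ℕ → ℂ} (n i : ℕ)
    (H : ∀ s, HasSum (fun x => g x s) (h s)) :
    HasSum (fun x => innerSumWith (g x) n i) (innerSumWith h n i) := by
  refine HasSum.add (hasSum_sum fun k _ => HasSum.mul_left _ (H _)) ?_
  by_cases hi : i = 0
  · simp [hi, hasSum_zero]
  · simp only [hi, if_false]
    exact hasSum_sum fun k _ => HasSum.mul_left _ (H _)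

lemma mul_innerSumWith (c : ℂ) (g : ℕ → ℂ) (n i : ℕ) :
    c * innerSumWith g n i = innerSumWith (fun s => c * g s) n i := by
  unfold innerSumWith
  rw [mul_add, mul_ite, mul_zero, mul_sum, mul_sum]
  congr 1
  · exact sum_congr rfl fun _ _ => by ring
  · congr 1
    exact sum_congr rfl fun _ _ => by ring

lemma hasSum_inv_pow_mul_pfSum {e : ℕ} (he : 2 ≤ e) (p q : ℕ) :
    HasSum (fun z : ℤ => (z : ℂ)⁻¹ ^ e * (pfSum (z : ℂ)⁻¹ p q intZeta + pfSum (z : ℂ)⁻¹ q p intZeta))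
      (zetaProdSum e p q) := by
  simp only [mul_add, pfSum, mul_sum]
  refine HasSum.add ?_ ?_ <;>
  · refine hasSum_sum fun k _ => ?_
    refine ((hasSum_inv_pow_int (k := e + _) (by omega)).mul_left _).of_eq (fun z => ?_) rfl
    rw [pow_add]
    ring

/-- The sum over the last variable of the `A₃` root product. -/
noncomputable def fiberSum (n : ℕ) (y : ℤ × ℤ) : ℂ :=
  (y.1 : ℂ)⁻¹ ^ n * ((y.2 : ℂ)⁻¹ ^ n * ((y.1 - y.2 : ℤ) : ℂ)⁻¹ ^ n) *
    pfSum (y.1 : ℂ)⁻¹ n n fun i =>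
      innerSum (y.2 : ℂ)⁻¹ n i + innerSum ((y.1 - y.2 : ℤ) : ℂ)⁻¹ n i

/-- The reciprocal `n`-th power of the product of the `A₃` roots. -/
noncomputable def rootTerm (n : ℕ) (y : (ℤ × ℤ) × ℤ) : ℂ :=
  (y.1.1 : ℂ)⁻¹ ^ n * ((y.1.2 : ℂ)⁻¹ ^ n * ((y.1.1 - y.1.2 : ℤ) : ℂ)⁻¹ ^ n) *
    ((y.2 : ℂ)⁻¹ ^ n * ((y.1.1 - y.2 : ℤ) : ℂ)⁻¹ ^ n * ((y.1.2 - y.2 : ℤ) : ℂ)⁻¹ ^ n)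

lemma hasSum_rootTerm_fiber {n : ℕ} (hn : 1 ≤ n) (he : Even n) (y : ℤ × ℤ) :
    HasSum (fun a : ℤ => rootTerm n (y, a)) (fiberSum n y) := by
  obtain ⟨z, R⟩ := y
  have hn0 : n ≠ 0 := by omega
  dsimp only [rootTerm, fiberSum]
  by_cases hz : z = 0
  · simp [hz, hn0, hasSum_zero]
  by_cases hR : R = 0
  · simp [hR, hn0, hasSum_zero]
  by_cases hzR : z - R = 0
  · simp [hzR, hn0, hasSum_zero]
  exact (hasSum_triple hn he hz hR hzR).mul_left _

lemma hasSum_fiberSum_fiber {n : ℕ} (hn : 1 ≤ n) (z : ℤ) :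
    HasSum (fun R : ℤ => fiberSum n (z, R))
      ((z : ℂ)⁻¹ ^ n * pfSum (z : ℂ)⁻¹ n n fun i => 2 * innerSumWith (fun s =>
        pfSum (z : ℂ)⁻¹ (n + s) n intZeta + pfSum (z : ℂ)⁻¹ n (n + s) intZeta) n i) := by
  have hn0 : n ≠ 0 := by omega
  dsimp only [fiberSum]
  by_cases hz : z = 0
  · simp [hz, hn0, hasSum_zero]
  have h : ∀ i, HasSum (fun R : ℤ => (R : ℂ)⁻¹ ^ n * ((z - R : ℤ) : ℂ)⁻¹ ^ n *
      innerSum (R : ℂ)⁻¹ n i) (innerSumWith (fun s =>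
        pfSum (z : ℂ)⁻¹ (n + s) n intZeta + pfSum (z : ℂ)⁻¹ n (n + s) intZeta) n i) := by
    intro i
    simp only [innerSum_eq, mul_innerSumWith]
    refine hasSum_innerSumWith n i fun s => ?_
    refine (hasSum_inv_pow_mul_inv_pow (p := n + s) (by omega) hn hz).of_eq (fun R => ?_) rfl
    rw [pow_add]
    ring
  have h2 : ∀ i, HasSum (fun R : ℤ => (R : ℂ)⁻¹ ^ n * ((z - R : ℤ) : ℂ)⁻¹ ^ n *
      (innerSum (R : ℂ)⁻¹ n i + innerSum ((z - R : ℤ) : ℂ)⁻¹ n i)) (2 * innerSumWith (fun s =>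
        pfSum (z : ℂ)⁻¹ (n + s) n intZeta + pfSum (z : ℂ)⁻¹ n (n + s) intZeta) n i) := by
    intro i
    refine ((h i).add ((Equiv.subLeft z).hasSum_iff.mpr (h i))).of_eq (fun R => ?_) (two_mul _)
    simp only [Function.comp_apply, Equiv.subLeft_apply, sub_sub_cancel]
    ring
  have h3 : HasSum _ (pfSum (z : ℂ)⁻¹ n n fun i => 2 * innerSumWith (fun s =>
        pfSum (z : ℂ)⁻¹ (n + s) n intZeta + pfSum (z : ℂ)⁻¹ n (n + s) intZeta) n i) :=
    hasSum_sum fun k _ => HasSum.mul_right _ (HasSum.mul_left _ (h2 k))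
  refine (h3.mul_left _).of_eq (fun R => ?_) rfl
  rw [mul_assoc, pfSum, mul_sum]
  congr 1
  refine sum_congr rfl fun k _ => ?_
  ring

lemma hasSum_fiberSum {n : ℕ} (hn : 2 ≤ n) :
    HasSum (fun z : ℤ => (z : ℂ)⁻¹ ^ n * pfSum (z : ℂ)⁻¹ n n fun i => 2 * innerSumWith (fun s =>
        pfSum (z : ℂ)⁻¹ (n + s) n intZeta + pfSum (z : ℂ)⁻¹ n (n + s) intZeta) n i)
      (∑ i ∈ range (n + 1), ((n + n - i - 1).choose (n - 1) : ℂ) * (2 *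
        innerSumWith (fun s => zetaProdSum (n + (n + n - i)) (n + s) n) n i)) := by
  unfold pfSum
  simp only [mul_sum]
  refine hasSum_sum fun i _ => ?_
  have h := hasSum_innerSumWith n i fun s =>
    hasSum_inv_pow_mul_pfSum (e := n + (n + n - i)) (by omega) (n + s) n
  refine ((h.mul_left 2).mul_left _).of_eq (fun z => ?_) rfl
  rw [← mul_innerSumWith, pow_add]
  simp only [pfSum]
  ring

/-- The sum over the whole lattice. -/
lemma eq_of_hasSum_rootTerm {n : ℕ} (hn : 2 ≤ n) (he : Even n) {s : ℂ} (h : HasSum (rootTerm n) s) :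
    s = ∑ i ∈ range (n + 1), ((n + n - i - 1).choose (n - 1) : ℂ) * (2 *
        innerSumWith (fun s => zetaProdSum (n + (n + n - i)) (n + s) n) n i) :=
  ((h.prod_fiberwise (hasSum_rootTerm_fiber (by omega) he)).prod_fiberwise
    (hasSum_fiberSum_fiber (by omega))).unique (hasSum_fiberSum hn)

/-- The strictly increasing integer quadruple with given successive gaps. -/
def gapQuadruple (p : ℕ+ × ℕ+ × ℕ+) : Fin 4 → ℤ :=
  ![0, p.1, p.1 + p.2.1, p.1 + p.2.1 + p.2.2]

lemma strictMono_gapQuadruple (p : ℕ+ × ℕ+ × ℕ+) : StrictMono (gapQuadruple p) := by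
  rw [Fin.strictMono_iff_lt_succ]
  intro i
  fin_cases i <;> simp [gapQuadruple]

/-- The parametrisation of the regular lattice points by Weyl group and dominant chamber. -/
def chamberMap (x : Equiv.Perm (Fin 4) × ℕ+ × ℕ+ × ℕ+) : (ℤ × ℤ) × ℤ :=
  let u := gapQuadruple x.2 ∘ x.1
  ((u 1 - u 0, u 2 - u 0), u 3 - u 0)

lemma chamberMap_injective : Function.Injective chamberMap := by
  rintro ⟨σ, p⟩ ⟨τ, q⟩ h
  simp only [chamberMap, Prod.mk.injEq, Function.comp_apply] at h
  set d := gapQuadruple p (σ 0) - gapQuadruple q (τ 0) with hd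
  have hu : ∀ i, gapQuadruple p (σ i) = gapQuadruple q (τ i) + d := by
    intro i
    fin_cases i <;> simp only [Fin.zero_eta, Fin.mk_one, Fin.reduceFinMk] <;> omega
  have hV : gapQuadruple p = fun i => gapQuadruple q i + d := by
    refine ((strictMono_gapQuadruple p).range_inj ((strictMono_gapQuadruple q).add_const d)).mp ?_
    rw [← σ.surjective.range_comp (gapQuadruple p),
      ← τ.surjective.range_comp (fun i => gapQuadruple q i + d)]
    exact congrArg Set.range (funext hu)
  have h0 := congrFun hV 0
  have h1 := congrFun hV 1
  have h2 := congrFun hV 2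
  have h3 := congrFun hV 3
  simp [gapQuadruple] at h0 h1 h2 h3
  have hpq : p = q := by
    refine Prod.ext ?_ (Prod.ext ?_ ?_) <;> refine PNat.coe_injective ?_ <;> omega
  subst hpq
  refine Prod.ext (Equiv.ext fun i => ?_) rfl
  refine (strictMono_gapQuadruple p).injective ?_
  rw [hu, ← h0]
  simp

lemma det_vandermonde_fin_four (v : Fin 4 → ℤ) :
    (Matrix.vandermonde v).det = (v 1 - v 0) * ((v 2 - v 0) * (v 3 - v 0)) *
      ((v 2 - v 1) * (v 3 - v 1)) * (v 3 - v 2) := by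
  rw [Matrix.det_vandermonde]
  have e0 : Finset.Ioi (0 : Fin 4) = {1, 2, 3} := by decide
  have e1 : Finset.Ioi (1 : Fin 4) = {2, 3} := by decide
  have e2 : Finset.Ioi (2 : Fin 4) = {3} := by decide
  have e3 : Finset.Ioi (3 : Fin 4) = ∅ := by decide
  simp [Fin.prod_univ_four, e0, e1, e2, e3]

/-- A term of the lattice sum is the even power of an inverse Vandermonde determinant. -/
lemma rootTerm_eq {n : ℕ} (he : Even n) (v : Fin 4 → ℤ) :
    rootTerm n ((v 1 - v 0, v 2 - v 0), v 3 - v 0) =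
      ((Matrix.vandermonde v).det : ℂ)⁻¹ ^ n := by
  have : (Matrix.vandermonde v).det = (v 1 - v 0) * ((v 2 - v 0) * (v 1 - v 0 - (v 2 - v 0))) *
      ((v 3 - v 0) * (v 1 - v 0 - (v 3 - v 0)) * -(v 2 - v 0 - (v 3 - v 0))) := by
    rw [det_vandermonde_fin_four]
    ring
  rw [this]
  simp only [Int.cast_mul, Int.cast_neg, mul_inv, mul_pow, inv_neg, he.neg_pow, rootTerm]

lemma rootTerm_chamberMap {n : ℕ} (he : Even n) (σ : Equiv.Perm (Fin 4)) (p : ℕ+ × ℕ+ × ℕ+) :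
    rootTerm n (chamberMap (σ, p)) = ((Matrix.vandermonde (gapQuadruple p)).det : ℂ)⁻¹ ^ n := by
  rw [chamberMap, rootTerm_eq he,
    show Matrix.vandermonde (gapQuadruple p ∘ σ) =
      (Matrix.vandermonde (gapQuadruple p)).submatrix σ id from rfl, Matrix.det_permute]
  rcases Int.units_eq_one_or (Equiv.Perm.sign σ) with h | h <;> simp [h, he.neg_pow, inv_neg]

lemma rootTerm_eq_zero_of_notMem_range {n : ℕ} (hn : n ≠ 0) (he : Even n) (y : (ℤ × ℤ) × ℤ)
    (hy : y ∉ Set.range chamberMap) : rootTerm n y = 0 := by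
  obtain ⟨⟨z, R⟩, X⟩ := y
  set v : Fin 4 → ℤ := ![0, z, R, X] with hv
  have h := rootTerm_eq he v
  simp only [show v 0 = 0 from rfl, show v 1 = z from rfl, show v 2 = R from rfl,
    show v 3 = X from rfl, sub_zero] at h
  rw [h]
  by_contra hne
  have hdet : (Matrix.vandermonde v).det ≠ 0 := by
    intro h0
    simp [h0, hn] at hne
  rw [Matrix.det_vandermonde_ne_zero_iff] at hdet
  have hmono : StrictMono (v ∘ Tuple.sort v) :=
    (Tuple.monotone_sort v).strictMono_of_injective (hdet.comp (Tuple.sort v).injective)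
  set g := v ∘ Tuple.sort v with hg
  have h01 : g 0 < g 1 := hmono (by decide)
  have h12 : g 1 < g 2 := hmono (by decide)
  have h23 : g 2 < g 3 := hmono (by decide)
  refine hy ⟨((Tuple.sort v)⁻¹, ⟨(g 1 - g 0).toNat, by omega⟩, ⟨(g 2 - g 1).toNat, by omega⟩,
    ⟨(g 3 - g 2).toNat, by omega⟩), ?_⟩
  have hgap : ∀ i, gapQuadruple (⟨(g 1 - g 0).toNat, by omega⟩, ⟨(g 2 - g 1).toNat, by omega⟩,
    ⟨(g 3 - g 2).toNat, by omega⟩) i = g i - g 0 := by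
    intro i
    fin_cases i <;> simp [gapQuadruple] <;> omega
  have hgv : ∀ i, g ((Tuple.sort v)⁻¹ i) = v i := by
    intro i
    simp [hg]
  simp only [chamberMap, Function.comp_apply, hgap, hgv]
  simp [hv]

/-- The summand of the Witten zeta function of `𝔰𝔩₄`, up to normalisation. -/
noncomputable def wittenTerm (n : ℕ) (p : ℕ+ × ℕ+ × ℕ+) : ℝ :=
  1 / (((p.1 * p.2.1 * p.2.2 * (p.1 + p.2.1) * (p.2.1 + p.2.2) *
        (p.1 + p.2.1 + p.2.2) : ℕ+) : ℕ) : ℝ) ^ n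

lemma inv_det_vandermonde_gapQuadruple_pow {n : ℕ} (p : ℕ+ × ℕ+ × ℕ+) :
    ((Matrix.vandermonde (gapQuadruple p)).det : ℂ)⁻¹ ^ n = (wittenTerm n p : ℂ) := by
  have : (Matrix.vandermonde (gapQuadruple p)).det = ((p.1 * p.2.1 * p.2.2 * (p.1 + p.2.1) *
      (p.2.1 + p.2.2) * (p.1 + p.2.1 + p.2.2) : ℕ+) : ℤ) := by
    rw [det_vandermonde_fin_four]
    simp [gapQuadruple]
    ring
  rw [this, wittenTerm]
  push_cast
  rw [inv_pow, one_div]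

lemma summable_wittenTerm {n : ℕ} (hn : 2 ≤ n) : Summable (wittenTerm n) := by
  have h : Summable fun a : ℕ+ => ((a : ℕ) : ℝ)⁻¹ ^ 2 := by
    have := (Real.summable_nat_pow_inv (p := 2)).mpr (by norm_num)
    exact (this.comp_injective PNat.coe_injective).congr fun a => (inv_pow _ _).symm
  have h0 : (0 : ℕ+ → ℝ) ≤ fun a : ℕ+ => ((a : ℕ) : ℝ)⁻¹ ^ 2 := fun a => by positivity
  have h2 := h.mul_of_nonneg h h0 h0
  have h3 := h.mul_of_nonneg h2 h0 (fun a => by positivity)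
  refine Summable.of_nonneg_of_le (fun p => by unfold wittenTerm; positivity) (fun p => ?_) h3
  obtain ⟨a, b, c⟩ := p
  simp only [wittenTerm]
  rw [← mul_pow, ← mul_pow, ← mul_inv, ← mul_inv, inv_pow, ← one_div]
  have hle : a * b * c ≤ a * b * c * (a + b) * (b + c) * (a + b + c) := by
    simp only [mul_assoc (a * b * c)]
    exact le_mul_of_one_le_right' one_le
  refine one_div_le_one_div_of_le (by positivity) ?_
  calc ((a : ℕ) * ((b : ℕ) * (c : ℕ)) : ℝ) ^ 2
      = (((a * b * c : ℕ+) : ℕ) : ℝ) ^ 2 := by push_cast; ring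
    _ ≤ (((a * b * c * (a + b) * (b + c) * (a + b + c) : ℕ+) : ℕ) : ℝ) ^ 2 := by
        gcongr
        exact_mod_cast hle
    _ ≤ _ := pow_le_pow_right₀ (by exact_mod_cast one_le) hn

lemma hasSum_rootTerm {n : ℕ} (hn : 2 ≤ n) (he : Even n) :
    HasSum (rootTerm n) (24 * ((∑' p, wittenTerm n p : ℝ) : ℂ)) := by
  rw [← chamberMap_injective.hasSum_iff (rootTerm_eq_zero_of_notMem_range (by omega) he)]
  have hw := Complex.hasSum_ofReal.mpr (summable_wittenTerm hn).hasSum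
  have hs : Summable (rootTerm n ∘ chamberMap) := by
    have := (summable_prod_of_nonneg (f := fun x : Equiv.Perm (Fin 4) × ℕ+ × ℕ+ × ℕ+ =>
      wittenTerm n x.2) (fun x => by unfold wittenTerm; positivity)).mpr
      ⟨fun _ => summable_wittenTerm hn, (hasSum_fintype _).summable⟩
    refine (Complex.summable_ofReal.mpr this).congr fun x => ?_
    rw [Function.comp_apply, rootTerm_chamberMap he, inv_det_vandermonde_gapQuadruple_pow]
  have h := hs.hasSum.prod_fiberwise fun σ => hw.of_eq (fun p => by
    rw [Function.comp_apply, rootTerm_chamberMap he, inv_det_vandermonde_gapQuadruple_pow]) rfl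
  have h24 := h.unique (hasSum_fintype _)
  refine hs.hasSum.of_eq (fun _ => rfl) ?_
  rw [h24]
  simp [Fintype.card_perm, Nat.factorial]

lemma sum_mul_intZeta (s : Finset ℕ) (f g : ℕ → ℂ) :
    ∑ k ∈ s, f k * intZeta k * g k =
      ∑ k ∈ s.filter (fun k => Even k), f k * (2 * riemannZeta k) * g k := by
  rw [sum_filter]
  refine sum_congr rfl fun k _ => ?_
  by_cases hk : Even k <;> simp [intZeta, hk]

lemma zetaProdSum_eq {e p q : ℕ} (h : Even (e + (p + q))) :
    zetaProdSum e p q = 4 *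
      ((∑ t ∈ (range (p + 1)).filter (fun t => Even t), ((p + q - t - 1).choose (q - 1) : ℂ) *
        riemannZeta t * riemannZeta ((e + (p + q - t) : ℕ) : ℂ)) +
      ∑ t ∈ (range (q + 1)).filter (fun t => Even t), ((p + q - t - 1).choose (p - 1) : ℂ) *
        riemannZeta t * riemannZeta ((e + (p + q - t) : ℕ) : ℂ)) := by
  rw [zetaProdSum, sum_mul_intZeta, sum_mul_intZeta, mul_add, mul_sum, mul_sum]
  have key : ∀ t ≤ p + q, Even t → Even (e + (p + q - t)) := fun t ht h2 => by
    rw [← Nat.add_sub_assoc ht, Nat.even_sub (by omega)]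
    tauto
  congr 1 <;>
  · refine sum_congr rfl fun t ht => ?_
    rw [mem_filter, mem_range] at ht
    have := key t (by omega) ht.2
    simp only [add_comm q p, intZeta, this, if_true]
    ring

lemma zetaProdSum_eq_of_even {m i k : ℕ} (hm : 1 ≤ m) (hi : i ≤ 2 * m) (hk : k ≤ 2 * m)
    (hke : Even k) :
    zetaProdSum (2 * m + (2 * m + 2 * m - i)) (4 * m + i - k) (2 * m) = 4 *
      ((∑ t ∈ (range (4 * m + i - k + 1)).filter (fun t => Even t),
        ((6 * m + i - k - t - 1).choose (2 * m - 1) : ℂ) *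
          riemannZeta t * riemannZeta ((12 * m - k - t : ℕ) : ℂ)) +
      ∑ t ∈ (range (2 * m + 1)).filter (fun t => Even t),
        ((6 * m + i - k - t - 1).choose (4 * m + i - k - 1) : ℂ) *
          riemannZeta t * riemannZeta ((12 * m - k - t : ℕ) : ℂ)) := by
  rw [zetaProdSum_eq (by grind)]
  congr 2 <;>
  · refine sum_congr rfl fun t _ => ?_
    rw [show 4 * m + i - k + 2 * m - t = 6 * m + i - k - t by omega]
    by_cases ht : t ≤ 6 * m + i - k
    · rw [show 2 * m + (2 * m + 2 * m - i) + (6 * m + i - k - t) = 12 * m - k - t by omega]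
    · grind

lemma innerSumWith_eq_wittenSl4 {m i : ℕ} (hm : 1 ≤ m) (hi : i ≤ 2 * m) :
    innerSumWith (fun s => zetaProdSum (2 * m + (2 * m + 2 * m - i)) (2 * m + s) (2 * m)) (2 * m) i =
      8 * (wittenSl4A m i + wittenSl4B m i + wittenSl4C m i + wittenSl4D m i) := by
  have hAB : (if i = 0 then 0 else ∑ k ∈ (range (2 * m + 1)).filter (fun k => Even k),
      ((2 * m + i - k - 1).choose (i - 1) : ℂ) * (2 * riemannZeta k) *
        zetaProdSum (2 * m + (2 * m + 2 * m - i)) (2 * m + (2 * m + i - k)) (2 * m)) =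
      8 * (wittenSl4A m i + wittenSl4B m i) := by
    by_cases h0 : i = 0
    · simp [wittenSl4A, wittenSl4B, h0]
    simp only [wittenSl4A, wittenSl4B, h0, if_false]
    rw [← sum_add_distrib, mul_sum]
    refine sum_congr rfl fun k hk => ?_
    rw [mem_filter, mem_range] at hk
    rw [show 2 * m + (2 * m + i - k) = 4 * m + i - k by omega,
      zetaProdSum_eq_of_even hm hi (by omega) hk.2]
    simp only [mul_add, mul_sum]
    congr 1 <;> exact sum_congr rfl fun t _ => by ring
  have hCD : (∑ k ∈ (range (i + 1)).filter (fun k => Even k),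
      ((i + 2 * m - k - 1).choose (2 * m - 1) : ℂ) * (2 * riemannZeta k) *
        zetaProdSum (2 * m + (2 * m + 2 * m - i)) (2 * m + (i + 2 * m - k)) (2 * m)) =
      8 * (wittenSl4C m i + wittenSl4D m i) := by
    rw [wittenSl4C, wittenSl4D, ← sum_add_distrib, mul_sum]
    refine sum_congr rfl fun k hk => ?_
    rw [mem_filter, mem_range] at hk
    have hc : (i + 2 * m - k - 1).choose (2 * m - 1) = (2 * m + i - k - 1).choose (i - k) := by
      rw [← Nat.choose_symm (by omega)]
      congr 1 <;> omega
    rw [show 2 * m + (i + 2 * m - k) = 4 * m + i - k by omega, hc,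
      zetaProdSum_eq_of_even hm hi (by omega) hk.2]
    simp only [mul_add, mul_sum]
    congr 1 <;> exact sum_congr rfl fun t _ => by ring
  rw [innerSumWith, sum_mul_intZeta, sum_mul_intZeta, hAB, hCD]
  ring

/-- Special values of the Witten zeta function of `𝔰𝔩₄` at even integers:
`24 ∑_{a,b,c ≥ 1} 1/(abc(a+b)(b+c)(a+b+c))^{2m}
  = 16 ∑_{i=0}^{2m} C(4m−i−1, 2m−1) (A_i + B_i + C_i + D_i)`,
the series on the left converging absolutely. -/
theorem witten_sl4_even_values (m : ℕ) (hm : 1 ≤ m) :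
    (Summable fun p : ℕ+ × ℕ+ × ℕ+ =>
      1 / (((p.1 * p.2.1 * p.2.2 * (p.1 + p.2.1) * (p.2.1 + p.2.2) *
        (p.1 + p.2.1 + p.2.2) : ℕ+) : ℕ) : ℝ) ^ (2 * m)) ∧
    (24 : ℂ) * ((∑' p : ℕ+ × ℕ+ × ℕ+,
        1 / (((p.1 * p.2.1 * p.2.2 * (p.1 + p.2.1) * (p.2.1 + p.2.2) *
          (p.1 + p.2.1 + p.2.2) : ℕ+) : ℕ) : ℝ) ^ (2 * m) : ℝ) : ℂ) =
      16 * ∑ i ∈ range (2 * m + 1),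
        ((4 * m - i - 1).choose (2 * m - 1) : ℂ) *
          (wittenSl4A m i + wittenSl4B m i + wittenSl4C m i + wittenSl4D m i) := by
  refine ⟨summable_wittenTerm (by omega), ?_⟩
  refine (eq_of_hasSum_rootTerm (by omega) (even_two_mul m)
    (hasSum_rootTerm (by omega) (even_two_mul m))).trans ?_
  rw [mul_sum]
  refine sum_congr rfl fun i hi => ?_
  rw [innerSumWith_eq_wittenSl4 hm (Nat.lt_succ_iff.mp (mem_range.mp hi)),
    show 2 * m + 2 * m = 4 * m by omega]
  ring
end

section
/- Σ_{a, b ≥ 1} 1/(a·b·(a+b))^2 = π^6/2835, where the sum ranges over all pairs of positive integers (a, b) and converges absolutely. -/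
theorem bernoulli'_six : bernoulli' 6 = 1 / 42 := by
  have bernoulli'_five : bernoulli' 5 = 0 := by
    rw [bernoulli'_def]
    norm_num [Finset.sum_range_succ, Nat.choose]
  rw [bernoulli'_def]
  norm_num [Finset.sum_range_succ, Nat.choose, bernoulli'_five]

theorem hasSum_zeta_six :
    HasSum (fun n : ℕ => (1 : ℝ) / (n : ℝ) ^ 6) (Real.pi ^ 6 / 945) := by
  convert! hasSum_zeta_nat three_ne_zero using 1
  simp only [Nat.reduceAdd, Nat.reduceMul, Nat.reduceSub]
  rw [bernoulli_eq_bernoulli'_of_ne_one (by decide), bernoulli'_six]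
  simp [Nat.factorial]
  ring

/-- The trichotomy `a = b`, `a < b`, `b < a` as a parametrization of pairs of positive integers. -/
def PNat.trichotomyParam : ℕ+ ⊕ (ℕ+ × ℕ+ ⊕ ℕ+ × ℕ+) → ℕ+ × ℕ+ :=
  Sum.elim (fun a => (a, a))
    (Sum.elim (fun p => (p.1, p.1 + p.2)) (fun p => (p.1 + p.2, p.2)))

theorem PNat.trichotomyParam_bijective : Function.Bijective PNat.trichotomyParam := by
  constructor
  · rintro (a | ⟨a, b⟩ | ⟨a, b⟩) (c | ⟨c, d⟩ | ⟨c, d⟩) h <;>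
      simp only [PNat.trichotomyParam, Sum.elim_inl, Sum.elim_inr, Prod.mk.injEq, ← PNat.coe_inj,
        PNat.add_coe, Sum.inl.injEq, Sum.inr.injEq, reduceCtorEq] at h ⊢ <;>
      have := a.pos <;> have := c.pos <;> try have := b.pos
    all_goals try have := d.pos
    all_goals omega
  · rintro ⟨a, b⟩
    rcases lt_trichotomy a b with h | rfl | h
    · exact ⟨.inr (.inl (a, b - a)), by simp [PNat.trichotomyParam, PNat.add_sub_of_lt h]⟩
    · exact ⟨.inl a, rfl⟩
    · exact ⟨.inr (.inr (a - b, b)), by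
        simp [PNat.trichotomyParam, add_comm (a - b), PNat.add_sub_of_lt h]⟩

theorem Summable.tsum_pnat_prod_eq_diag_add {f : ℕ+ × ℕ+ → ℝ} (hf : Summable f) :
    ∑' p, f p = ∑' a, f (a, a) +
      (∑' p : ℕ+ × ℕ+, f (p.1, p.1 + p.2) + ∑' p : ℕ+ × ℕ+, f (p.1 + p.2, p.2)) := by
  have h := hf.comp_injective PNat.trichotomyParam_bijective.injective
  have h_inr := h.comp_injective Sum.inr_injective
  rw [← (Equiv.ofBijective _ PNat.trichotomyParam_bijective).tsum_eq f]
  exact ((h.comp_injective Sum.inl_injective).hasSum.sum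
    ((h_inr.comp_injective Sum.inl_injective).hasSum.sum
      (h_inr.comp_injective Sum.inr_injective).hasSum)).tsum_eq

theorem one_div_cube_mul_cube_eq {x y : ℝ} (hx : 0 < x) (hy : 0 < y) :
    1 / (x ^ 3 * y ^ 3) = 1 / (x ^ 3 * (x + y) ^ 3) + 1 / ((x + y) ^ 3 * y ^ 3) +
      3 * (1 / (x * y * (x + y)) ^ 2) := by
  have := (add_pos hx hy).ne'
  field_simp
  ring

/-- `∑_{a,b ≥ 1} 1/(ab(a+b))² = π⁶/2835`, the series converging absolutely. -/
theorem witten_sl3_at_two :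
    (Summable fun p : ℕ+ × ℕ+ =>
      1 / (((p.1 * p.2 * (p.1 + p.2) : ℕ+) : ℕ) : ℝ) ^ 2) ∧
    (∑' p : ℕ+ × ℕ+, 1 / (((p.1 * p.2 * (p.1 + p.2) : ℕ+) : ℕ) : ℝ) ^ 2) =
      Real.pi ^ 6 / 2835 := by
  let f : ℕ+ × ℕ+ → ℝ := fun p => 1 / ((p.1 : ℝ) ^ 3 * (p.2 : ℝ) ^ 3)
  let g : ℕ+ × ℕ+ → ℝ := fun p => 1 / (((p.1 * p.2 * (p.1 + p.2) : ℕ+) : ℕ) : ℝ) ^ 2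
  change Summable g ∧ ∑' p, g p = Real.pi ^ 6 / 2835
  have h_cube : Summable fun n : ℕ+ => 1 / (n : ℝ) ^ 3 :=
    (Real.summable_one_div_nat_pow.2 (by norm_num : 1 < 3)).comp_injective PNat.coe_injective
  have hf : Summable f :=
    (h_cube.mul_of_nonneg h_cube (fun _ => by positivity) (fun _ => by positivity)).congr
      fun p => by simp only [f]; rw [one_div_mul_one_div]
  have hfg (p : ℕ+ × ℕ+) : f p = f (p.1, p.1 + p.2) + f (p.1 + p.2, p.2) + 3 * g p := by
    simpa [f, g] using one_div_cube_mul_cube_eq (x := p.1) (y := p.2)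
      (by exact_mod_cast p.1.pos) (by exact_mod_cast p.2.pos)
  have hf₁ : Summable fun p : ℕ+ × ℕ+ => f (p.1, p.1 + p.2) :=
    hf.comp_injective (i := fun p : ℕ+ × ℕ+ => (p.1, p.1 + p.2))
      (PNat.trichotomyParam_bijective.injective.comp
        (Sum.inr_injective.comp Sum.inl_injective))
  have hf₂ : Summable fun p : ℕ+ × ℕ+ => f (p.1 + p.2, p.2) :=
    hf.comp_injective (i := fun p : ℕ+ × ℕ+ => (p.1 + p.2, p.2))
      (PNat.trichotomyParam_bijective.injective.comp
        (Sum.inr_injective.comp Sum.inr_injective))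
  have hg : Summable g :=
    (((hf.sub hf₁).sub hf₂).mul_left (1 / 3)).congr fun p => by linarith [hfg p]
  refine ⟨hg, ?_⟩
  have h_diag : ∑' a : ℕ+, f (a, a) = Real.pi ^ 6 / 945 := by
    rw [← hasSum_zeta_six.tsum_eq, ← tsum_pnat_eq_tsum_of_eq_zero (by simp)]
    exact tsum_congr fun a => by simp only [f]; rw [← pow_add]
  have h_split := hf.tsum_pnat_prod_eq_diag_add
  rw [tsum_congr hfg, (hf₁.add hf₂).tsum_add (hg.mul_left 3), hf₁.tsum_add hf₂, tsum_mul_left,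
    h_diag] at h_split
  linarith
end
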